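/- arXiv:1112.1183 — 3 statements merged into one kernel-verified Lean document; each statement's English description precedes it below -/
import Mathlib

section
/- Let a_1 a_2 ⋯ be a sequence of non-negative integers satisfying (G) and (L). Then there exists a unique β > 1 such that −Σ_{j≥1} (a_j+1)/(−β)^j = 1 and, for every k ≥ 1, −Σ_{j≥1} (a_{k+j}+1)/(−β)^j ∈ [0,1]. Moreover, Σ_{j≥1} (a_{k+j}+1)/(−β)^j ≠ 0 for all k ≥ 1 if and only if a_1 a_2 ⋯ satisfies conditions (A1) and (A2). -/
open Filter Set

/-- The (−β)-transformation on [−β/(β+1), 1/(β+1)). -/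
noncomputable def negBetaT (β : ℝ) (x : ℝ) : ℝ := -β * x - ⌊β / (β + 1) - β * x⌋

/-- The digits of the (−β)-expansion of x; `negBetaDigit β x n` is ε_{n+1}(x). -/
noncomputable def negBetaDigit (β : ℝ) (x : ℝ) (n : ℕ) : ℤ :=
  ⌊β / (β + 1) - β * ((negBetaT β)^[n] x)⌋

/-- The (−β)-expansion of the left endpoint −β/(β+1); index n represents a_{n+1}. -/
noncomputable def negBetaExp (β : ℝ) (n : ℕ) : ℤ := negBetaDigit β (-β / (β + 1)) n

/-- `b` is the (−β)-expansion of `x`. -/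
def IsNegBetaExpOf (β : ℝ) (x : ℝ) (b : ℕ → ℤ) : Prop :=
  x ∈ Set.Ico (-β / (β + 1)) (1 / (β + 1)) ∧ ∀ n, b n = negBetaDigit β x n

/-- Alternating lexicographic strict order (0-based indexing: index k corresponds
to position k+1, so `Even k` means odd position). -/
def AltLt (x y : ℕ → ℤ) : Prop :=
  ∃ k, (∀ i, i < k → x i = y i) ∧ (if Even k then x k < y k else y k < x k)

/-- Alternating lexicographic order. -/
def AltLe (x y : ℕ → ℤ) : Prop := AltLt x y ∨ x = y

def phiW : ℕ → List ℕ
  | 1 => [1, 0, 0]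
  | _ => [1]

/-- `uWord n` is φ^n(1), where φ(1) = 100, φ(0) = 1. -/
def uWord : ℕ → List ℕ
  | 0 => [1]
  | n + 1 => (uWord n).flatMap phiW

/-- The sequence u = 100111001001001110011⋯ starting with φ^n(1) for all n. -/
def uSeq (n : ℕ) : ℤ := ((uWord (n + 1)).getD n 0 : ℕ)

/-- Condition (G): every shifted sequence is ≤_alt the sequence itself. -/
def CondG (a : ℕ → ℤ) : Prop := ∀ k, 1 ≤ k → AltLe (fun n => a (n + k)) a

/-- Condition (L): a >_alt u. -/
def CondL (a : ℕ → ℤ) : Prop := AltLt uSeq a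

/-- The periodic sequence (w)^∞. -/
def perSeq (w : List ℤ) : ℕ → ℤ := fun n => w.getD (n % w.length) 0

/-- `a` is an infinite concatenation of blocks from `S`. -/
def IsInfConcat (S : Set (List ℤ)) (a : ℕ → ℤ) : Prop :=
  ∃ w : ℕ → List ℤ, (∀ n, w n ∈ S) ∧
    ∀ N i, i < (((List.range N).map w).flatten).length →
      (((List.range N).map w).flatten).getD i 0 = a i

/-- Condition (A1). -/
def CondA1 (a : ℕ → ℤ) : Prop :=
  ∀ k, 1 ≤ k → AltLt uSeq (perSeq ((List.range k).map a)) →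
    IsInfConcat {(List.range k).map a, (List.range (k - 1)).map a ++ [a (k - 1) - 1, 0]} a →
    a = perSeq ((List.range k).map a)

/-- Condition (A2). -/
def CondA2 (a : ℕ → ℤ) : Prop :=
  ∀ k, 1 ≤ k → AltLt uSeq (perSeq ((List.range (k - 1)).map a ++ [a (k - 1) + 1])) →
    ¬ IsInfConcat {(List.range k).map a ++ [0], (List.range (k - 1)).map a ++ [a (k - 1) + 1]} a

/-- The cylinder set I_{b_1⋯b_n}. -/
def cylinder (β : ℝ) (w : List ℤ) : Set ℝ :=
  {x | x ∈ Set.Ico (-β / (β + 1)) (1 / (β + 1)) ∧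
    ∀ i, i < w.length → negBetaDigit β x i = w.getD i 0}

/-- L_{β,n}: the number of words of length n with nonempty cylinder. -/
noncomputable def Lnum (β : ℝ) (n : ℕ) : ℕ :=
  Set.ncard {w : List ℤ | w.length = n ∧ (cylinder β w).Nonempty}

/-- L'_{β,n}: the number of words of length n whose cylinder is an interval of
positive length. -/
noncomputable def Lnum' (β : ℝ) (n : ℕ) : ℕ :=
  Set.ncard {w : List ℤ | w.length = n ∧
    ∃ c d : ℝ, c < d ∧ Set.Ioo c d ⊆ cylinder β w ∧ cylinder β w ⊆ Set.Icc c d}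

/-- P_n(x) = (−x)^n + Σ_{j=1}^n (a_j+1)(−x)^{n−j}. -/
noncomputable def Pn (a : ℕ → ℤ) (n : ℕ) (x : ℝ) : ℝ :=
  (-x) ^ n + ∑ j ∈ Finset.range n, ((a j : ℝ) + 1) * (-x) ^ (n - 1 - j)

/-- J_n = {x > 1 : P_j(x) ∈ [0,1] for all 1 ≤ j ≤ n}. -/
def Jn (a : ℕ → ℤ) (n : ℕ) : Set ℝ :=
  {x | 1 < x ∧ ∀ j, 1 ≤ j → j ≤ n → Pn a j x ∈ Set.Icc (0 : ℝ) 1}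

namespace NegBeta

open MeasureTheory

/-! ### The alternating lexicographic order -/

theorem exists_first_ne {x y : ℕ → ℤ} (h : x ≠ y) :
    ∃ j, (∀ i, i < j → x i = y i) ∧ x j ≠ y j := by
  classical
  have hex : ∃ j, x j ≠ y j := by
    by_contra! hc
    exact h (funext hc)
  exact ⟨Nat.find hex, fun i hi => not_not.1 (Nat.find_min hex hi), Nat.find_spec hex⟩

theorem altLt_iff_of_first_ne {x y : ℕ → ℤ} {j : ℕ} (heq : ∀ i, i < j → x i = y i)
    (hne : x j ≠ y j) : AltLt x y ↔ (if Even j then x j < y j else y j < x j) := by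
  refine ⟨?_, fun h => ⟨j, heq, h⟩⟩
  rintro ⟨k, hk, hlt⟩
  rcases lt_trichotomy k j with h | h | h
  · rw [heq k h] at hlt
    split_ifs at hlt <;> omega
  · subst h
    exact hlt
  · exact absurd (hk j h) hne

theorem altLt_irrefl (x : ℕ → ℤ) : ¬ AltLt x x := by
  rintro ⟨k, -, h⟩
  split_ifs at h <;> omega

theorem altLt_trichotomy (x y : ℕ → ℤ) : AltLt x y ∨ x = y ∨ AltLt y x := by
  by_cases h : x = y
  · exact Or.inr (Or.inl h)
  · obtain ⟨j, heq, hne⟩ := exists_first_ne h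
    rw [altLt_iff_of_first_ne heq hne,
      altLt_iff_of_first_ne (fun i hi => (heq i hi).symm) hne.symm]
    split_ifs <;> omega

theorem _root_.AltLt.trans {x y z : ℕ → ℤ} (hxy : AltLt x y) (hyz : AltLt y z) : AltLt x z := by
  obtain ⟨j, hj, hjlt⟩ := hxy
  obtain ⟨k, hk, hklt⟩ := hyz
  rcases lt_trichotomy j k with h | h | h
  · refine ⟨j, fun i hi => (hj i hi).trans (hk i (hi.trans h)), ?_⟩
    rwa [← hk j h]
  · subst h
    refine ⟨j, fun i hi => (hj i hi).trans (hk i hi), ?_⟩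
    split_ifs at * <;> omega
  · refine ⟨k, fun i hi => (hj i (hi.trans h)).trans (hk i hi), ?_⟩
    rwa [hj k h]

theorem _root_.AltLe.trans_lt {x y z : ℕ → ℤ} (hxy : AltLe x y) (hyz : AltLt y z) : AltLt x z := by
  rcases hxy with h | rfl
  · exact h.trans hyz
  · exact hyz

theorem _root_.AltLe.trans {x y z : ℕ → ℤ} (hxy : AltLe x y) (hyz : AltLe y z) : AltLe x z := by
  rcases hyz with h | rfl
  · exact Or.inl (hxy.trans_lt h)
  · exact hxy

theorem altLe_of_not_altLt {x y : ℕ → ℤ} (h : ¬ AltLt x y) : AltLe y x := by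
  rcases altLt_trichotomy x y with h1 | h1 | h1
  · exact absurd h1 h
  · exact Or.inr h1.symm
  · exact Or.inl h1

theorem _root_.AltLe.not_altLt {x y : ℕ → ℤ} (h : AltLe x y) : ¬ AltLt y x :=
  fun h' => altLt_irrefl _ (h.trans_lt h')

theorem _root_.AltLt.exists_agreement {x y : ℕ → ℤ} (h : AltLt x y) :
    ∃ K, ∀ x' y' : ℕ → ℤ, (∀ i ≤ K, x' i = x i) → (∀ i ≤ K, y' i = y i) → AltLt x' y' := by
  obtain ⟨K, hK, hlt⟩ := h
  refine ⟨K, fun x' y' hx hy => ⟨K, fun i hi => ?_, ?_⟩⟩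
  · rw [hx i hi.le, hy i hi.le, hK i hi]
  · rwa [hx K le_rfl, hy K le_rfl]

/-! ### Shifts, orbits and values of digit sequences -/

/-- The sequence obtained by dropping the first `k` terms. -/
def shift (s : ℕ → ℤ) (k : ℕ) : ℕ → ℤ := fun n => s (k + n)

@[simp] theorem shift_zero (s : ℕ → ℤ) : shift s 0 = s := by
  funext n; simp [shift]

theorem shift_shift (s : ℕ → ℤ) (k l : ℕ) : shift (shift s k) l = shift s (k + l) := by
  funext n; simp [shift, add_assoc]

theorem shift_apply (s : ℕ → ℤ) (k n : ℕ) : shift s k n = s (k + n) := rfl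

/-- The orbit of `x` under the maps `y ↦ d + 1 - β y`, with `d` running through the digits `s`. -/
noncomputable def orb (β x : ℝ) (s : ℕ → ℤ) : ℕ → ℝ
  | 0 => x
  | n + 1 => (s n : ℝ) + 1 - β * orb β x s n

@[simp] theorem orb_zero (β x : ℝ) (s : ℕ → ℤ) : orb β x s 0 = x := rfl

theorem orb_succ (β x : ℝ) (s : ℕ → ℤ) (n : ℕ) :
    orb β x s (n + 1) = (s n : ℝ) + 1 - β * orb β x s n := rfl

theorem orb_add (β x : ℝ) (s : ℕ → ℤ) (m n : ℕ) :
    orb β x s (m + n) = orb β (orb β x s m) (shift s m) n := by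
  induction n with
  | zero => rfl
  | succ n ih => rw [← add_assoc, orb_succ, orb_succ, ih, shift_apply]

theorem orb_sub_orb (β x y : ℝ) {s t : ℕ → ℤ} {n : ℕ} (h : ∀ i < n, s i = t i) :
    orb β x s n - orb β y t n = (-β) ^ n * (x - y) := by
  induction n with
  | zero => simp
  | succ n ih =>
    rw [orb_succ, orb_succ, h n (Nat.lt_succ_self n), pow_succ]
    linear_combination (-β) * ih (fun i hi => h i (hi.trans (Nat.lt_succ_self n)))

theorem orb_congr (β x : ℝ) {s t : ℕ → ℤ} {n : ℕ} (h : ∀ i < n, s i = t i) :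
    orb β x s n = orb β x t n := by
  have := orb_sub_orb β x x h
  simp at this
  linarith

/-- `s` codes an orbit of `1` that stays in `[0, 1]`. -/
def Valid (β : ℝ) (s : ℕ → ℤ) : Prop :=
  (∀ n, 0 ≤ s n) ∧ ∀ n, orb β 1 s n ∈ Icc (0 : ℝ) 1

theorem eq_zero_of_int_sub {x y : ℝ} (hx : x ∈ Icc (0 : ℝ) 1) (hy : y ∈ Icc (0 : ℝ) 1) {d : ℤ}
    (hd : d ≠ 0) (h : x - y = d) : (x = 1 ∧ y = 0 ∧ d = 1) ∨ (x = 0 ∧ y = 1 ∧ d = -1) := by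
  obtain ⟨hx0, hx1⟩ := hx
  obtain ⟨hy0, hy1⟩ := hy
  rcases lt_or_gt_of_ne hd with h1 | h1
  · right
    have h2 : (d : ℝ) ≤ -1 := by exact_mod_cast Int.le_sub_one_of_lt h1
    have : (-1 : ℝ) ≤ d := by linarith
    have h3 : (-1 : ℤ) ≤ d := by exact_mod_cast this
    exact ⟨by linarith, by linarith, by omega⟩
  · left
    have h2 : (1 : ℝ) ≤ d := by exact_mod_cast h1
    have : (d : ℝ) ≤ 1 := by linarith
    have h3 : d ≤ (1 : ℤ) := by exact_mod_cast this
    exact ⟨by linarith, by linarith, by omega⟩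

/-- Two codings of orbits of the same point in `[0, 1]` first differ where one orbit reaches `0`
and the other one reaches `1`. -/
theorem orb_of_first_ne {β x : ℝ} {s t : ℕ → ℤ} {j : ℕ} (heq : ∀ i < j, s i = t i)
    (hne : s j ≠ t j) (hs : orb β x s (j + 1) ∈ Icc (0 : ℝ) 1)
    (ht : orb β x t (j + 1) ∈ Icc (0 : ℝ) 1) :
    (orb β x s (j + 1) = 1 ∧ orb β x t (j + 1) = 0 ∧ s j = t j + 1) ∨
      (orb β x s (j + 1) = 0 ∧ orb β x t (j + 1) = 1 ∧ t j = s j + 1) := by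
  have h : orb β x s (j + 1) - orb β x t (j + 1) = ((s j - t j : ℤ) : ℝ) := by
    rw [orb_succ, orb_succ, orb_congr β x heq]
    push_cast
    ring
  rcases eq_zero_of_int_sub hs ht (sub_ne_zero.2 hne) h with h | h
  · exact Or.inl ⟨h.1, h.2.1, by omega⟩
  · exact Or.inr ⟨h.1, h.2.1, by omega⟩

theorem continuous_orb (x : ℝ) (s : ℕ → ℤ) (n : ℕ) : Continuous fun β => orb β x s n := by
  induction n with
  | zero => exact continuous_const
  | succ n ih =>
    simp only [orb_succ]
    fun_prop

theorem Valid.digit_le {β : ℝ} {s : ℕ → ℤ} (h : Valid β s) (hβ : 1 < β) (n : ℕ) :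
    (s n : ℝ) ≤ β := by
  have h1 := (h.2 (n + 1)).2
  have h2 := (h.2 n).2
  rw [orb_succ] at h1
  nlinarith

/-- The value `-∑ (s_j + 1) / (-β)^j`. -/
noncomputable def val (β : ℝ) (s : ℕ → ℤ) : ℝ := -(∑' j : ℕ, ((s j : ℝ) + 1) / (-β) ^ (j + 1))

theorem summable_val {β : ℝ} (hβ : 1 < β) {s : ℕ → ℤ} {N : ℝ} (hs0 : ∀ n, 0 ≤ s n)
    (hsN : ∀ n, (s n : ℝ) ≤ N) : Summable fun j : ℕ => ((s j : ℝ) + 1) / (-β) ^ (j + 1) := by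
  have hβ0 : 0 < β := by linarith
  refine Summable.of_norm_bounded (g := fun j : ℕ => ((N + 1) / β) * (1 / β) ^ j) ?_ ?_
  · exact (summable_geometric_of_lt_one (by positivity)
      ((div_lt_one hβ0).2 hβ)).mul_left _
  · intro j
    have h0 : (0 : ℝ) ≤ s j := by exact_mod_cast hs0 j
    rw [norm_div, norm_pow, norm_neg, Real.norm_of_nonneg hβ0.le,
      Real.norm_of_nonneg (by linarith : (0 : ℝ) ≤ (s j : ℝ) + 1), one_div, inv_pow, pow_succ,
      div_mul_eq_mul_div, ← div_eq_mul_inv, div_div]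
    gcongr
    exact hsN j

theorem val_rec {β : ℝ} (hβ : 1 < β) {s : ℕ → ℤ} {N : ℝ} (hs0 : ∀ n, 0 ≤ s n)
    (hsN : ∀ n, (s n : ℝ) ≤ N) : val β (shift s 1) = (s 0 : ℝ) + 1 - β * val β s := by
  have hβ0 : β ≠ 0 := by linarith
  have h := (summable_val hβ hs0 hsN).tsum_eq_zero_add
  unfold val
  rw [h]
  have h2 : (∑' j : ℕ, ((s (j + 1) : ℝ) + 1) / (-β) ^ (j + 1 + 1)) =
      (∑' j : ℕ, ((shift s 1 j : ℝ) + 1) / (-β) ^ (j + 1)) / (-β) := by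
    rw [← tsum_div_const]
    refine tsum_congr fun j => ?_
    rw [shift_apply, add_comm 1 j, pow_succ (-β) (j + 1), div_div]
  rw [h2]
  generalize (∑' j : ℕ, ((shift s 1 j : ℝ) + 1) / (-β) ^ (j + 1)) = A
  rw [zero_add, pow_one, div_neg, div_neg]
  field_simp
  ring

theorem abs_val_le {β : ℝ} (hβ : 1 < β) {s : ℕ → ℤ} {N : ℝ} (hs0 : ∀ n, 0 ≤ s n)
    (hsN : ∀ n, (s n : ℝ) ≤ N) : |val β s| ≤ (N + 1) / (β - 1) := by
  have hβ0 : 0 < β := by linarith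
  have hg : HasSum (fun j : ℕ => ((N + 1) / β) * (1 / β) ^ j) (((N + 1) / β) * (1 - 1 / β)⁻¹) :=
    (hasSum_geometric_of_lt_one (by positivity) ((div_lt_one hβ0).2 hβ)).mul_left _
  have hle : ‖∑' j : ℕ, ((s j : ℝ) + 1) / (-β) ^ (j + 1)‖ ≤ ((N + 1) / β) * (1 - 1 / β)⁻¹ := by
    refine tsum_of_norm_bounded hg fun j => ?_
    have h0 : (0 : ℝ) ≤ s j := by exact_mod_cast hs0 j
    rw [norm_div, norm_pow, norm_neg, Real.norm_of_nonneg hβ0.le,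
      Real.norm_of_nonneg (by linarith : (0 : ℝ) ≤ (s j : ℝ) + 1), one_div, inv_pow, pow_succ,
      div_mul_eq_mul_div, ← div_eq_mul_inv, div_div]
    gcongr
    exact hsN j
  rw [val, abs_neg]
  refine hle.trans (le_of_eq ?_)
  have : β - 1 ≠ 0 := by linarith
  field_simp

theorem orb_val {β : ℝ} (hβ : 1 < β) {s : ℕ → ℤ} {N : ℝ} (hs0 : ∀ n, 0 ≤ s n)
    (hsN : ∀ n, (s n : ℝ) ≤ N) (n : ℕ) : orb β (val β s) s n = val β (shift s n) := by
  induction n with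
  | zero => simp
  | succ n ih =>
    rw [orb_succ, ih, ← shift_shift s n 1,
      val_rec hβ (s := shift s n) (fun m => hs0 _) (fun m => hsN _)]
    simp [shift_apply]

/-- A bounded real sequence, each of whose terms is at most the image of another term under
the contraction `x ↦ (x + c) / β`, is bounded by the fixed point `c / (β - 1)`. -/
theorem le_of_contraction {e : ℕ → ℝ} {β c M : ℝ} (hβ : 1 < β) (hM : ∀ k, e k ≤ M)
    (h : ∀ k, ∃ l, e k ≤ (e l + c) / β) (k : ℕ) : e k ≤ c / (β - 1) := by
  have hβ0 : 0 < β := by linarith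
  have hβ1 : β - 1 ≠ 0 := by linarith
  have key : ∀ n : ℕ, ∀ k, e k - c / (β - 1) ≤ |M - c / (β - 1)| * (1 / β) ^ n := by
    intro n
    induction n with
    | zero =>
      intro k
      rw [pow_zero, mul_one]
      exact (sub_le_sub_right (hM k) _).trans (le_abs_self _)
    | succ n ih =>
      intro k
      obtain ⟨l, hl⟩ := h k
      have h1 : (e l + c) / β - c / (β - 1) = (e l - c / (β - 1)) * (1 / β) := by
        field_simp
        ring
      calc e k - c / (β - 1) ≤ (e l - c / (β - 1)) * (1 / β) := by linarith
        _ ≤ |M - c / (β - 1)| * (1 / β) ^ n * (1 / β) := by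
            have := ih l
            gcongr
        _ = _ := by rw [pow_succ, mul_assoc]
  have hlim : Tendsto (fun n : ℕ => |M - c / (β - 1)| * (1 / β) ^ n) atTop (nhds 0) := by
    have := (tendsto_pow_atTop_nhds_zero_of_lt_one (r := 1 / β) (by positivity)
      ((div_lt_one hβ0).2 hβ)).const_mul |M - c / (β - 1)|
    simpa using this
  have := ge_of_tendsto' hlim (fun n => key n k)
  linarith

/-- A bounded orbit determines the value of its coding. -/
theorem val_eq_of_orb {β x : ℝ} (hβ : 1 < β) {s : ℕ → ℤ} (hs0 : ∀ n, 0 ≤ s n)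
    (hx : ∀ n, orb β x s n ∈ Icc (0 : ℝ) 1) (n : ℕ) : val β (shift s n) = orb β x s n := by
  have hsN : ∀ n, (s n : ℝ) ≤ β := by
    intro n
    have h1 := (hx (n + 1)).2
    have h2 := (hx n).2
    rw [orb_succ] at h1
    nlinarith
  have hd : ∀ k, |val β (shift s k) - orb β x s k| ≤ 0 / (β - 1) := by
    refine le_of_contraction (M := (β + 1) / (β - 1) + 1) hβ (fun k => ?_) (fun k => ⟨k + 1, ?_⟩)
    · have h1 := abs_val_le hβ (s := shift s k) (fun m => hs0 _) (fun m => hsN _)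
      have h2 : |orb β x s k| ≤ 1 := abs_le.2 ⟨by linarith [(hx k).1], (hx k).2⟩
      exact (abs_sub _ _).trans (add_le_add h1 h2)
    · rw [← orb_val hβ hs0 hsN, ← orb_val hβ hs0 hsN, orb_succ, orb_succ]
      have : (s k : ℝ) + 1 - β * orb β (val β s) s k - (s k + 1 - β * orb β x s k) =
        (-β) * (orb β (val β s) s k - orb β x s k) := by ring
      have hβ0 : β ≠ 0 := by linarith
      rw [this, abs_mul, abs_neg, abs_of_pos (by linarith : (0 : ℝ) < β), add_zero,
        mul_div_cancel_left₀ _ hβ0]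
  have := hd n
  rw [zero_div] at this
  have := abs_nonpos_iff.1 this
  linarith

theorem Valid.val_shift {β : ℝ} {s : ℕ → ℤ} (h : Valid β s) (hβ : 1 < β) (n : ℕ) :
    val β (shift s n) = orb β 1 s n := val_eq_of_orb hβ h.1 h.2 n

theorem Valid.val_shift_mem {β : ℝ} {s : ℕ → ℤ} (h : Valid β s) (hβ : 1 < β) (n : ℕ) :
    val β (shift s n) ∈ Icc (0 : ℝ) 1 := by
  rw [h.val_shift hβ]
  exact h.2 n

theorem Valid.val_eq {β : ℝ} {s : ℕ → ℤ} (h : Valid β s) (hβ : 1 < β) : val β s = 1 := by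
  have := h.val_shift hβ 0
  simpa using this

theorem valid_of_val {β : ℝ} (hβ : 1 < β) {s : ℕ → ℤ} {N : ℝ} (hs0 : ∀ n, 0 ≤ s n)
    (hsN : ∀ n, (s n : ℝ) ≤ N) (h1 : val β s = 1)
    (h : ∀ n, val β (shift s n) ∈ Icc (0 : ℝ) 1) : Valid β s := by
  refine ⟨hs0, fun n => ?_⟩
  have h2 := orb_val hβ hs0 hsN n
  rw [h1] at h2
  rw [h2]
  exact h n

/-- Comparison of values of sequences with a common initial segment of length `j`. -/
theorem val_sub_val {β : ℝ} (hβ : 1 < β) {s t : ℕ → ℤ} {N N' : ℝ} (hs0 : ∀ n, 0 ≤ s n)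
    (hsN : ∀ n, (s n : ℝ) ≤ N) (ht0 : ∀ n, 0 ≤ t n) (htN : ∀ n, (t n : ℝ) ≤ N') {j : ℕ}
    (h : ∀ i < j, s i = t i) :
    (val β s - val β t) * β ^ (j + 1) =
      (-1) ^ j * (((s j - t j : ℤ) : ℝ) - (val β (shift s (j + 1)) - val β (shift t (j + 1)))) := by
  rw [← orb_val hβ hs0 hsN, ← orb_val hβ ht0 htN, orb_succ, orb_succ]
  have h1 := orb_sub_orb β (val β s) (val β t) h
  have h2 : ((-1 : ℝ) ^ j) * (-1) ^ j = 1 := by rw [← mul_pow]; simp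
  rw [neg_pow] at h1
  push_cast
  rw [pow_succ]
  linear_combination (-1) ^ j * (-β) * h1 - β * β ^ j * (val β s - val β t) * h2

theorem val_le_add_of_altLe {β : ℝ} (hβ : 1 < β) {s t : ℕ → ℤ} {N N' e e' : ℝ}
    (hs0 : ∀ n, 0 ≤ s n) (hsN : ∀ n, (s n : ℝ) ≤ N) (ht0 : ∀ n, 0 ≤ t n)
    (htN : ∀ n, (t n : ℝ) ≤ N') (he : 0 ≤ e) (he' : 0 ≤ e')
    (hs : ∀ n, val β (shift s (n + 1)) ∈ Icc (-e) (1 + e))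
    (ht : ∀ n, val β (shift t (n + 1)) ∈ Icc (-e') (1 + e')) (hle : AltLe s t) :
    val β s ≤ val β t + (e + e') / β := by
  have hβ0 : 0 < β := by linarith
  rcases hle with ⟨j, hj, hlt⟩ | rfl
  · have h := val_sub_val hβ hs0 hsN ht0 htN hj
    have hs' := hs j
    have ht' := ht j
    have hle : (val β s - val β t) * β ^ (j + 1) ≤ e + e' := by
      rw [h]
      by_cases hj2 : Even j
      · rw [if_pos hj2] at hlt
        rw [hj2.neg_one_pow, one_mul]
        have h3 : ((s j - t j : ℤ) : ℝ) ≤ -1 := by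
          have : s j - t j ≤ -1 := by omega
          exact_mod_cast this
        linarith [hs'.1, hs'.2, ht'.1, ht'.2]
      · rw [if_neg hj2] at hlt
        rw [(Nat.not_even_iff_odd.1 hj2).neg_one_pow]
        have h3 : (1 : ℝ) ≤ ((s j - t j : ℤ) : ℝ) := by
          have : 1 ≤ s j - t j := by omega
          exact_mod_cast this
        linarith [hs'.1, hs'.2, ht'.1, ht'.2]
    have h4 : β ≤ β ^ (j + 1) := le_self_pow₀ hβ.le (by omega)
    by_contra! hc
    have h5 : (e + e') / β < val β s - val β t := by linarith
    rw [div_lt_iff₀ hβ0] at h5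
    have h6 : 0 ≤ val β s - val β t := by
      have : 0 ≤ (e + e') / β := by positivity
      linarith
    nlinarith [mul_le_mul_of_nonneg_left h4 h6]
  · have : 0 ≤ (e + e') / β := by positivity
    linarith

/-- If all shifts of `s` are bounded by a valid sequence, then their values lie in `[0, 1]`. -/
theorem val_shift_mem_of_altLe {β : ℝ} (hβ : 1 < β) {b s : ℕ → ℤ} {N : ℝ} (hb : Valid β b)
    (hs0 : ∀ n, 0 ≤ s n) (hsN : ∀ n, (s n : ℝ) ≤ N) (hle : ∀ k, AltLe (shift s k) b) (k : ℕ) :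
    val β (shift s k) ∈ Icc (0 : ℝ) 1 := by
  have hβ0 : 0 < β := by linarith
  have hN : 0 ≤ N := le_trans (by exact_mod_cast hs0 0) (hsN 0)
  have hrec : ∀ k, val β (shift s (k + 1)) = (s k : ℝ) + 1 - β * val β (shift s k) := by
    intro k
    rw [← orb_val hβ hs0 hsN, ← orb_val hβ hs0 hsN, orb_succ]
  have key : ∀ n : ℕ, ∀ k, val β (shift s k) ∈
      Icc (-((N + 1) / (β - 1) * (1 / β) ^ n)) (1 + ((N + 1) / (β - 1) * (1 / β) ^ n)) := by
    intro n
    induction n with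
    | zero =>
      intro k
      have := abs_le.1 (abs_val_le hβ (s := shift s k) (fun m => hs0 _) (fun m => hsN _))
      rw [pow_zero, mul_one]
      exact ⟨this.1, by linarith [this.2]⟩
    | succ n ih =>
      intro k
      set e := (N + 1) / (β - 1) * (1 / β) ^ n with he
      have he0 : 0 ≤ e := by
        have : 0 < β - 1 := by linarith
        positivity
      have hee : (N + 1) / (β - 1) * (1 / β) ^ (n + 1) = e / β := by
        rw [he, pow_succ]; ring
      rw [hee]
      constructor
      · have h1 := (ih (k + 1)).2
        rw [hrec] at h1
        have h2 : (0 : ℝ) ≤ s k := by exact_mod_cast hs0 k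
        rw [neg_le, le_div_iff₀ hβ0]
        linarith
      · have h1 := val_le_add_of_altLe hβ (s := shift s k) (t := b) (e := e) (e' := 0)
          (fun m => hs0 _) (fun m => hsN _) hb.1 (hb.digit_le hβ) he0 le_rfl
          (fun m => by rw [shift_shift]; exact ih _)
          (fun m => by simpa using hb.val_shift_mem hβ (m + 1)) (hle k)
        rw [hb.val_eq hβ, add_zero] at h1
        exact h1
  have hlim : Tendsto (fun n : ℕ => (N + 1) / (β - 1) * (1 / β) ^ n) atTop (nhds 0) := by
    have := (tendsto_pow_atTop_nhds_zero_of_lt_one (r := 1 / β) (by positivity)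
      ((div_lt_one hβ0).2 hβ)).const_mul ((N + 1) / (β - 1))
    simpa using this
  constructor
  · have := ge_of_tendsto' hlim (fun n => neg_le.1 (key n k).1)
    linarith
  · have := ge_of_tendsto' hlim (fun n => sub_le_iff_le_add'.2 (key n k).2)
    linarith

/-! ### The transformation `x ↦ ⌊βx⌋ + 1 - βx` and its codings -/

/-- The transformation `x ↦ ⌊βx⌋ + 1 - βx`, with values in `(0, 1]`. -/
noncomputable def tmap (β x : ℝ) : ℝ := ⌊β * x⌋ + 1 - β * x

/-- The digits of the expansion of `x` generated by `tmap β`. -/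
noncomputable def code (β x : ℝ) (n : ℕ) : ℤ := ⌊β * (tmap β)^[n] x⌋

theorem tmap_pos (β x : ℝ) : 0 < tmap β x := by
  have := Int.lt_floor_add_one (β * x)
  unfold tmap
  linarith

theorem tmap_le_one (β x : ℝ) : tmap β x ≤ 1 := by
  have := Int.floor_le (β * x)
  unfold tmap
  linarith

theorem tmap_zero (β : ℝ) : tmap β 0 = 1 := by simp [tmap]

theorem tmap_iterate_mem {β x : ℝ} (hx : x ∈ Icc (0 : ℝ) 1) (n : ℕ) :
    (tmap β)^[n] x ∈ Icc (0 : ℝ) 1 := by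
  cases n with
  | zero => exact hx
  | succ n =>
    rw [Function.iterate_succ_apply']
    exact ⟨(tmap_pos _ _).le, tmap_le_one _ _⟩

theorem orb_code (β x : ℝ) (n : ℕ) : orb β x (code β x) n = (tmap β)^[n] x := by
  induction n with
  | zero => rfl
  | succ n ih =>
    rw [orb_succ, ih, Function.iterate_succ_apply']
    rfl

theorem shift_code (β x : ℝ) (k : ℕ) : shift (code β x) k = code β ((tmap β)^[k] x) := by
  funext n
  rw [shift_apply, code, code, add_comm k n, Function.iterate_add_apply]

theorem code_zero (β x : ℝ) : code β x 0 = ⌊β * x⌋ := rfl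

theorem code_nonneg {β x : ℝ} (hβ : 0 ≤ β) (hx : x ∈ Icc (0 : ℝ) 1) (n : ℕ) :
    0 ≤ code β x n :=
  Int.floor_nonneg.2 (mul_nonneg hβ (tmap_iterate_mem hx n).1)

theorem code_le {β x : ℝ} (hβ : 0 ≤ β) (hx : x ∈ Icc (0 : ℝ) 1) (n : ℕ) :
    (code β x n : ℝ) ≤ β :=
  (Int.floor_le _).trans (mul_le_of_le_one_right hβ (tmap_iterate_mem hx n).2)

theorem val_code {β x : ℝ} (hβ : 1 < β) (hx : x ∈ Icc (0 : ℝ) 1) : val β (code β x) = x := by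
  have := val_eq_of_orb (x := x) hβ (code_nonneg (by linarith) hx)
    (fun n => by rw [orb_code]; exact tmap_iterate_mem hx n) 0
  simpa using this

theorem one_mem_Icc : (1 : ℝ) ∈ Icc (0 : ℝ) 1 := ⟨zero_le_one, le_rfl⟩

theorem valid_code {β : ℝ} (hβ : 1 < β) : Valid β (code β 1) :=
  ⟨code_nonneg (by linarith) one_mem_Icc, fun n => by
    rw [orb_code]; exact tmap_iterate_mem one_mem_Icc n⟩

theorem floor_eq_of_lt {x : ℝ} {d : ℤ} (h1 : (d : ℝ) ≤ x) (h2 : x < d + 1) : ⌊x⌋ = d :=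
  Int.floor_eq_iff.2 ⟨h1, h2⟩

/-- The finite set consisting of `0` and the first `k` points of the orbit of `1`. -/
noncomputable def orbitSet (β : ℝ) (k : ℕ) : Finset ℝ :=
  insert 0 ((Finset.range k).image fun i => (tmap β)^[i] 1)

theorem zero_mem_orbitSet (β : ℝ) (k : ℕ) : 0 ∈ orbitSet β k := Finset.mem_insert_self _ _

theorem iterate_mem_orbitSet (β : ℝ) {k i : ℕ} (hi : i < k) : (tmap β)^[i] 1 ∈ orbitSet β k :=
  Finset.mem_insert_of_mem (Finset.mem_image.2 ⟨i, Finset.mem_range.2 hi, rfl⟩)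

theorem one_mem_orbitSet (β : ℝ) {k : ℕ} (hk : 1 ≤ k) : 1 ∈ orbitSet β k :=
  iterate_mem_orbitSet β (i := 0) hk

theorem orbitSet_subset {β : ℝ} {k : ℕ} {z : ℝ} (hz : z ∈ orbitSet β k) : z ∈ Icc (0 : ℝ) 1 := by
  rcases Finset.mem_insert.1 hz with rfl | h
  · exact ⟨le_rfl, zero_le_one⟩
  · obtain ⟨i, -, rfl⟩ := Finset.mem_image.1 h
    exact tmap_iterate_mem one_mem_Icc i

theorem tmap_mem_orbitSet {β : ℝ} {k : ℕ} (hk : 1 ≤ k) (h : (tmap β)^[k] 1 = 1) {z : ℝ}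
    (hz : z ∈ orbitSet β k) : tmap β z ∈ orbitSet β k := by
  rcases Finset.mem_insert.1 hz with rfl | hz
  · rw [tmap_zero]
    exact one_mem_orbitSet β hk
  · obtain ⟨i, hi, rfl⟩ := Finset.mem_image.1 hz
    rw [← Function.iterate_succ_apply' (tmap β)]
    rcases Nat.lt_or_ge (i + 1) k with h1 | h1
    · exact iterate_mem_orbitSet β h1
    · have : i.succ = k := by
        have := Finset.mem_range.1 hi
        omega
      rw [this, h]
      exact one_mem_orbitSet β hk

theorem card_orbitSet_erase_le (β : ℝ) {k : ℕ} (hk : 1 ≤ k) :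
    ((orbitSet β k).erase 1).card ≤ k := by
  rw [Finset.card_erase_of_mem (one_mem_orbitSet β hk)]
  have h1 := Finset.card_insert_le (0 : ℝ) ((Finset.range k).image fun i => (tmap β)^[i] 1)
  have h2 : ((Finset.range k).image fun i => (tmap β)^[i] (1 : ℝ)).card ≤ k :=
    Finset.card_image_le.trans (Finset.card_range k).le
  unfold orbitSet
  omega

/-- If the orbit of `1` returns to `1` after `k` steps then `β ^ k ≥ 2`. -/
theorem two_le_pow_of_iterate {β : ℝ} (hβ : 1 < β) {k : ℕ} (hk : 1 ≤ k)
    (h : (tmap β)^[k] 1 = 1) : 2 ≤ β ^ k := by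
  classical
  by_contra! hlt
  have hβ0 : 0 < β := by linarith
  set Z := orbitSet β k with hZ
  have h0 : (0 : ℝ) ∈ Z := zero_mem_orbitSet β k
  have h1 : (1 : ℝ) ∈ Z := one_mem_orbitSet β hk
  obtain ⟨p, hp, hpmin⟩ := Finset.exists_min_image ((Z ×ˢ Z).filter fun p => p.1 < p.2)
    (fun p => p.2 - p.1) ⟨(0, 1), by simp [h0, h1]⟩
  simp only [Finset.mem_filter, Finset.mem_product] at hp
  set g := p.2 - p.1 with hg
  have hg0 : 0 < g := by linarith [hp.2]
  have hgap : ∀ u ∈ Z, ∀ v ∈ Z, u < v → g ≤ v - u := fun u hu v hv huv =>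
    hpmin (u, v) (by simp [hu, hv, huv])
  have hpow : ∀ i ≤ k, β ^ i < 2 := fun i hi =>
    (pow_le_pow_right₀ hβ.le hi).trans_lt hlt
  have key : ∀ i, i ≤ k → ∃ u ∈ Z, ∃ v ∈ Z, v - u = β ^ i * g := by
    intro i
    induction i with
    | zero => exact fun _ => ⟨p.1, hp.1.1, p.2, hp.1.2, by simp [hg]⟩
    | succ i ih =>
      intro hi
      obtain ⟨u, hu, v, hv, huv⟩ := ih (by omega)
      have hTu := tmap_mem_orbitSet hk h hu
      have hTv := tmap_mem_orbitSet hk h hv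
      have hlt' : u < v := by
        have : 0 < β ^ i * g := by positivity
        linarith
      rcases lt_trichotomy (β * v) (⌊β * u⌋ + 1) with h2 | h2 | h2
      · have hfl : ⌊β * v⌋ = ⌊β * u⌋ :=
          floor_eq_of_lt ((Int.floor_le _).trans (by gcongr)) h2
        refine ⟨_, hTv, _, hTu, ?_⟩
        rw [tmap, tmap, hfl, pow_succ]
        linear_combination β * huv
      · refine ⟨0, h0, _, hTu, ?_⟩
        rw [tmap, pow_succ]
        linear_combination β * huv - h2
      · exfalso
        have h3 := hgap 0 h0 _ hTu (tmap_pos _ _)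
        have h4 : g ≤ β * v - (⌊β * u⌋ + 1) := by
          have h5 : ((⌊β * u⌋ + 1 : ℤ) : ℝ) ≤ ⌊β * v⌋ := by
            exact_mod_cast Int.le_floor.2 (by push_cast; exact h2.le)
          push_cast at h5
          rcases (tmap_le_one β v).lt_or_eq with h6 | h6
          · have := hgap _ hTv 1 h1 h6
            rw [tmap] at this
            linarith
          · rw [tmap] at h6
            have h7 : (⌊β * u⌋ + 1 : ℤ) < ⌊β * v⌋ := by
              have : ((⌊β * u⌋ + 1 : ℤ) : ℝ) < ⌊β * v⌋ := by push_cast; linarith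
              exact_mod_cast this
            have h8 : ((⌊β * u⌋ + 1 + 1 : ℤ) : ℝ) ≤ ⌊β * v⌋ := by exact_mod_cast h7
            push_cast at h8
            have := hgap 0 h0 1 h1 one_pos
            linarith
        have h9 : 2 * g ≤ β ^ (i + 1) * g := by
          rw [tmap] at h3
          have : β ^ (i + 1) * g = β * v - β * u := by
            rw [pow_succ]; linear_combination (-β) * huv
          linarith
        have := le_of_mul_le_mul_right h9 hg0
        linarith [hpow _ hi]
  choose! u hu v hv huv using key
  obtain ⟨i, hi, j, hj, hij, huij⟩ := Finset.exists_ne_map_eq_of_card_lt_of_maps_to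
    (s := Finset.range (k + 1)) (t := Z.erase 1) (f := u)
    (by rw [Finset.card_range]; exact Nat.lt_succ_of_le (card_orbitSet_erase_le β hk))
    (by
      intro i hi
      have hi' : i ≤ k := Nat.lt_succ_iff.1 (Finset.mem_range.1 hi)
      refine Finset.mem_coe.2 (Finset.mem_erase.2 ⟨?_, hu i hi'⟩)
      have h2 := (orbitSet_subset (hv i hi')).2
      have h3 := huv i hi'
      have : 0 < β ^ i * g := by positivity
      intro h4
      linarith)
  have aux : ∀ i j, i < j → j ≤ k → u i ≠ u j := by
    intro i j hij hj huij
    have h2 := huv i (by omega)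
    have h3 := huv j hj
    have h4 : 1 ≤ β ^ i := one_le_pow₀ hβ.le
    have h5 : β ^ i < β ^ j := pow_lt_pow_right₀ hβ hij
    have h6 := hpow j hj
    have h7 := hgap (v i) (hv i (by omega)) (v j) (hv j hj) (by nlinarith)
    nlinarith
  have hi' := Nat.lt_succ_iff.1 (Finset.mem_range.1 hi)
  have hj' := Nat.lt_succ_iff.1 (Finset.mem_range.1 hj)
  rcases lt_or_gt_of_ne hij with h2 | h2
  · exact aux i j h2 hj' huij
  · exact aux j i h2 hi' huij.symm

/-! ### Strict monotonicity at parameters with a periodic orbit of `1` -/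

theorem volume_preimage_affine {γ : ℝ} (hγ : 0 < γ) (d : ℝ) (s : Set ℝ) :
    volume ((fun y => d - γ * y) ⁻¹' s) = ENNReal.ofReal γ⁻¹ * volume s := by
  have h1 : ((fun y => d - γ * y) ⁻¹' s) = ((-γ) * ·) ⁻¹' ((fun y => d + y) ⁻¹' s) := by
    ext y
    simp [sub_eq_add_neg]
  rw [h1, Real.volume_preimage_mul_left (by linarith), measure_preimage_add, inv_neg, abs_neg,
    abs_of_pos (inv_pos.2 hγ)]

theorem clamp_left {s t a b : ℝ} (hst : s < t) (h : max s (min t a) < max s (min t b)) :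
    max s (min t a) = a ∨ (max s (min t a) = s ∧ a ≤ s ∧ s < b) := by
  rcases le_total t a with h1 | h1
  · rw [min_eq_left h1, max_eq_right hst.le] at h
    exact absurd h (not_lt.2 (max_le hst.le (min_le_left _ _)))
  · rw [min_eq_right h1] at h ⊢
    rcases le_total s a with h2 | h2
    · exact Or.inl (max_eq_right h2)
    · refine Or.inr ⟨max_eq_left h2, h2, ?_⟩
      rw [max_eq_left h2] at h
      rcases lt_max_iff.1 h with h3 | h3
      · exact absurd h3 (lt_irrefl _)
      · exact h3.trans_le (min_le_right _ _)

theorem clamp_right {s t a b : ℝ} (hst : s < t) (h : max s (min t a) < max s (min t b)) :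
    max s (min t b) = b ∨ (max s (min t b) = t ∧ a < t ∧ t < b) := by
  rcases lt_trichotomy t b with h1 | h1 | h1
  · right
    rw [min_eq_left h1.le, max_eq_right hst.le] at h ⊢
    refine ⟨rfl, ?_, h1⟩
    by_contra! h2
    rw [min_eq_left h2, max_eq_right hst.le] at h
    exact lt_irrefl _ h
  · left
    rw [← h1, min_self, max_eq_right hst.le]
  · left
    rw [min_eq_right h1.le] at h ⊢
    rcases lt_max_iff.1 ((le_max_left _ _).trans_lt h) with h2 | h2
    · exact absurd h2 (lt_irrefl _)
    · exact max_eq_right h2.le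

/-- If `h` semiconjugates `tmap γ`, restricted to an invariant set `Y`, to a branch selection of
the maps `x ↦ d + 1 - β x`, with `β < γ` such that the orbit of `1` under `tmap β` is periodic,
then `Y` is a null set. -/
theorem volume_eq_zero_of_semiconj {β γ : ℝ} (hβ : 1 < β) (hβγ : β < γ) {k : ℕ} (hk : 1 ≤ k)
    (hper : (tmap β)^[k] 1 = 1) {Y : Set ℝ} {h : ℝ → ℝ} (hY : Y ⊆ Icc 0 1)
    (hh : ∀ y ∈ Y, h y ∈ Icc (0 : ℝ) 1) (hT : ∀ y ∈ Y, tmap γ y ∈ Y)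
    (hrec : ∀ y ∈ Y, h (tmap γ y) = (⌊γ * y⌋ : ℝ) + 1 - β * h y) : volume Y = 0 := by
  classical
  have hβ0 : 0 < β := by linarith
  have hγ0 : 0 < γ := by linarith
  set M : Set ℝ → ℝ := fun S => volume.real (Y ∩ h ⁻¹' S) with hM
  have hYfin : volume Y ≠ ⊤ := ne_top_of_le_ne_top (by simp) (measure_mono hY)
  have hfin : ∀ S : Set ℝ, volume (Y ∩ h ⁻¹' S) ≠ ⊤ := fun S =>
    ne_top_of_le_ne_top hYfin (measure_mono inter_subset_left)
  have hM0 : ∀ S, 0 ≤ M S := fun S => measureReal_nonneg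
  have hMmono : ∀ S S' : Set ℝ, S ⊆ S' → M S ≤ M S' := fun S S' hS =>
    measureReal_mono (inter_subset_inter_right _ (preimage_mono hS)) (hfin _)
  have hMunion : ∀ S S' : Set ℝ, M (S ∪ S') ≤ M S + M S' := fun S S' => by
    rw [hM]
    simp only
    rw [preimage_union, inter_union_distrib_left]
    exact measureReal_union_le _ _
  have core : ∀ (S : Set ℝ) (D : Finset ℤ) (S' : ℤ → Set ℝ),
      (∀ y ∈ Y, h y ∈ S → ⌊γ * y⌋ ∈ D ∧ h (tmap γ y) ∈ S' ⌊γ * y⌋) →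
      γ * M S ≤ ∑ d ∈ D, M (S' d) := by
    intro S D S' hS
    have hsub : Y ∩ h ⁻¹' S ⊆ ⋃ d ∈ D, (fun y => ((d : ℝ) + 1) - γ * y) ⁻¹' (Y ∩ h ⁻¹' (S' d)) := by
      rintro y ⟨hy, hyS⟩
      obtain ⟨h1, h2⟩ := hS y hy hyS
      exact mem_biUnion (x := ⌊γ * y⌋) h1 ⟨hT y hy, h2⟩
    have hone : ∀ d : ℤ, volume.real ((fun y => ((d : ℝ) + 1) - γ * y) ⁻¹' (Y ∩ h ⁻¹' (S' d))) =
        γ⁻¹ * M (S' d) := by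
      intro d
      rw [measureReal_def, volume_preimage_affine hγ0, ENNReal.toReal_mul,
        ENNReal.toReal_ofReal (inv_pos.2 hγ0).le]
      rfl
    have h1 : M S ≤ ∑ d ∈ D, γ⁻¹ * M (S' d) := by
      refine (measureReal_mono hsub ?_).trans
        ((measureReal_biUnion_finset_le _ _).trans
          (le_of_eq (Finset.sum_congr rfl fun d _ => hone d)))
      refine ((measure_biUnion_finset_le _ _).trans_lt (ENNReal.sum_lt_top.2 fun d _ => ?_)).ne
      rw [volume_preimage_affine hγ0]
      exact ENNReal.mul_lt_top ENNReal.ofReal_lt_top (hfin _).lt_top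
    rw [← Finset.mul_sum] at h1
    calc γ * M S ≤ γ * (γ⁻¹ * ∑ d ∈ D, M (S' d)) := by gcongr
      _ = _ := by field_simp
  have hdig : ∀ y ∈ Y, h (tmap γ y) ∈ Icc (0 : ℝ) 1 := fun y hy => hh _ (hT y hy)
  have hdig0 : ∀ y ∈ Y, 0 ≤ ⌊γ * y⌋ := fun y hy =>
    Int.floor_nonneg.2 (mul_nonneg hγ0.le (hY hy).1)
  have hfloor : ∀ y ∈ Y, tmap β (h y) ≠ 1 → ⌊γ * y⌋ = ⌊β * h y⌋ := by
    intro y hy hne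
    have h1 := hdig y hy
    rw [hrec y hy] at h1
    rcases h1.1.lt_or_eq with h2 | h2
    · exact (floor_eq_of_lt (by linarith [h1.2]) (by linarith)).symm
    · exfalso
      apply hne
      have h3 : β * h y = ((⌊γ * y⌋ + 1 : ℤ) : ℝ) := by push_cast; linarith
      rw [tmap, h3, Int.floor_intCast]
      ring
  have hpt : ∀ z, tmap β z ≠ 1 → γ * M {z} ≤ M {tmap β z} := by
    intro z hz
    have := core {z} {⌊β * z⌋} (fun _ => {tmap β z}) (by
      rintro y hy rfl
      have h1 := hfloor y hy hz
      refine ⟨by simp [h1], ?_⟩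
      rw [mem_singleton_iff, hrec y hy, h1, tmap])
    simpa using this
  have hpt1 : ∀ z, tmap β z = 1 → γ * M {z} ≤ M {1} + M {0} := by
    intro z hz
    have hz' : (⌊β * z⌋ : ℝ) = β * z := by
      rw [tmap] at hz
      linarith
    have := core {z} {⌊β * z⌋, ⌊β * z⌋ - 1} (fun d => if d = ⌊β * z⌋ then {1} else {0}) (by
      rintro y hy rfl
      have h1 := hdig y hy
      rw [hrec y hy] at h1
      have h2 : (⌊γ * y⌋ : ℝ) ≤ (⌊β * h y⌋ : ℝ) := by linarith [h1.2]
      have h3 : ((⌊β * h y⌋ - 1 : ℤ) : ℝ) ≤ (⌊γ * y⌋ : ℝ) := by push_cast; linarith [h1.1]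
      have h2' : ⌊γ * y⌋ ≤ ⌊β * h y⌋ := by exact_mod_cast h2
      have h3' : ⌊β * h y⌋ - 1 ≤ ⌊γ * y⌋ := by exact_mod_cast h3
      have h4 : ⌊γ * y⌋ = ⌊β * h y⌋ ∨ ⌊γ * y⌋ = ⌊β * h y⌋ - 1 := by omega
      rcases h4 with h4 | h4
      · refine ⟨by simp [h4], ?_⟩
        rw [if_pos h4, mem_singleton_iff, hrec y hy, h4, hz']
        ring
      · refine ⟨by simp [h4], ?_⟩
        rw [if_neg (by omega), mem_singleton_iff, hrec y hy, h4]
        push_cast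
        rw [hz']
        ring)
    rw [Finset.sum_pair (by omega), if_pos rfl, if_neg (by omega)] at this
    exact this
  have hpt0 : γ * M {0} ≤ M {1} := by
    have := core {0} {0} (fun _ => {1}) (by
      intro y hy hy0
      rw [mem_singleton_iff] at hy0
      have h1 := hdig y hy
      rw [hrec y hy, hy0] at h1
      have h2 : (⌊γ * y⌋ : ℝ) ≤ (0 : ℤ) := by push_cast; linarith [h1.2]
      have h2' : ⌊γ * y⌋ ≤ 0 := by exact_mod_cast h2
      have h3 : ⌊γ * y⌋ = 0 := le_antisymm h2' (hdig0 y hy)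
      refine ⟨by simp [h3], ?_⟩
      rw [mem_singleton_iff, hrec y hy, h3, hy0]
      simp)
    simpa using this
  have hM1 : M {1} = 0 := by
    by_contra hne
    have hpos : 0 < M {1} := lt_of_le_of_ne (hM0 _) (Ne.symm hne)
    have hex : ∃ m, 1 ≤ m ∧ (tmap β)^[m] 1 = 1 := ⟨k, hk, hper⟩
    set m := Nat.find hex with hm
    obtain ⟨hm1, hm2⟩ := Nat.find_spec hex
    have hmin : ∀ i, i < m → 1 ≤ i → (tmap β)^[i] 1 ≠ 1 := fun i hi h1 h2 =>
      Nat.find_min hex hi ⟨h1, h2⟩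
    have hpow : ∀ i, i + 1 ≤ m → γ ^ i * M {1} ≤ M {(tmap β)^[i] 1} := by
      intro i
      induction i with
      | zero => intro _; simp
      | succ i ih =>
        intro hi
        have h1 := ih (by omega)
        have h2 := hpt ((tmap β)^[i] 1) (by
          rw [← Function.iterate_succ_apply' (tmap β)]
          exact hmin _ (by omega) (by omega))
        rw [Function.iterate_succ_apply', pow_succ]
        nlinarith
    obtain ⟨l, hl⟩ : ∃ l, m = l + 1 := ⟨m - 1, by omega⟩
    have h1 := hpow l (by omega)
    have h2 := hpt1 ((tmap β)^[l] 1) (by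
      rw [← Function.iterate_succ_apply' (tmap β)]
      have : l.succ = m := hl.symm
      rw [this]
      exact hm2)
    have h3 : 2 ≤ β ^ m := two_le_pow_of_iterate hβ hm1 hm2
    have h4 : β ^ m ≤ γ ^ m := pow_le_pow_left₀ hβ0.le hβγ.le m
    have h5 : γ ^ m * M {1} ≤ M {1} + M {0} := by
      rw [hl, pow_succ]
      nlinarith
    have h6 : 2 * M {1} ≤ M {1} + M {0} := by nlinarith
    nlinarith
  have hM00 : M {0} = 0 := by
    have := hM0 {0}
    nlinarith
  have hE : M {z | tmap β z = 1} = 0 := by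
    have h1 : volume (Y ∩ h ⁻¹' {z | tmap β z = 1}) = 0 := by
      refine measure_mono_null (t := ⋃ e : ℤ, Y ∩ h ⁻¹' {(e : ℝ) / β}) ?_ ?_
      · rintro y ⟨hy, hy1⟩
        refine mem_iUnion.2 ⟨⌊β * h y⌋, hy, ?_⟩
        have hy1' : tmap β (h y) = 1 := hy1
        rw [tmap] at hy1'
        rw [mem_preimage, mem_singleton_iff, eq_div_iff hβ0.ne']
        linarith
      · refine measure_iUnion_null fun e => ?_
        have h2 : tmap β ((e : ℝ) / β) = 1 := by
          rw [tmap, mul_div_cancel₀ _ hβ0.ne', Int.floor_intCast]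
          ring
        have h3 := hpt1 _ h2
        have h4 := hM0 {(e : ℝ) / β}
        have h5 : M {(e : ℝ) / β} = 0 := by nlinarith
        exact (measureReal_eq_zero_iff (hfin _)).1 h5
    rw [hM]
    simp only
    rw [measureReal_def, h1, ENNReal.toReal_zero]
  set Z := orbitSet β k with hZ
  have h0Z : (0 : ℝ) ∈ Z := zero_mem_orbitSet β k
  have h1Z : (1 : ℝ) ∈ Z := one_mem_orbitSet β hk
  obtain ⟨p, hp, hpmax⟩ := Finset.exists_max_image ((Z ×ˢ Z).filter fun p => p.1 < p.2)
    (fun p => M (Ioo p.1 p.2) / (p.2 - p.1)) ⟨(0, 1), by simp [h0Z, h1Z]⟩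
  simp only [Finset.mem_filter, Finset.mem_product] at hp
  obtain ⟨s, t⟩ := p
  obtain ⟨⟨hs, ht⟩, hst⟩ := hp
  simp only at hs ht hst hpmax
  set C := M (Ioo s t) / (t - s) with hC
  have hst0 : 0 < t - s := by linarith
  have hC0 : 0 ≤ C := div_nonneg (hM0 _) hst0.le
  have hCle : ∀ u ∈ Z, ∀ v ∈ Z, u < v → M (Ioo u v) ≤ C * (v - u) := by
    intro u hu v hv huv
    have := hpmax (u, v) (by simp [hu, hv, huv])
    rwa [div_le_iff₀ (by linarith)] at this
  obtain ⟨N, hN⟩ := exists_nat_gt β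
  set q : ℤ → ℝ := fun d => max s (min t ((d : ℝ) / β)) with hq
  have hsI := orbitSet_subset hs
  have htI := orbitSet_subset ht
  have hpiece : ∀ d : ℤ, M (Ioo ((d : ℝ) + 1 - β * q (d + 1)) ((d : ℝ) + 1 - β * q d)) ≤
      C * β * (q (d + 1) - q d) := by
    intro d
    have hdd : (d : ℝ) / β < ((d + 1 : ℤ) : ℝ) / β := by
      push_cast
      gcongr
      linarith
    have hmono : q d ≤ q (d + 1) := max_le_max le_rfl (min_le_min le_rfl hdd.le)
    rcases hmono.lt_or_eq with hlt | heq
    · have hleft : (d : ℝ) + 1 - β * q d ∈ Z := by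
        have h2 : q d = (d : ℝ) / β ∨ (q d = s ∧ (d : ℝ) / β ≤ s ∧ s < ((d + 1 : ℤ) : ℝ) / β) :=
          clamp_left hst hlt
        rcases h2 with h2 | ⟨h2, h3, h4⟩
        · rw [h2, mul_div_cancel₀ _ hβ0.ne']
          simpa using h1Z
        · rw [h2]
          have h5 : ⌊β * s⌋ = d := by
            rw [div_le_iff₀ hβ0] at h3
            rw [lt_div_iff₀ hβ0] at h4
            push_cast at h4
            exact floor_eq_of_lt (by linarith) (by linarith)
          have := tmap_mem_orbitSet hk hper hs
          rwa [tmap, h5] at this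
      have hright : (d : ℝ) + 1 - β * q (d + 1) ∈ Z := by
        have h2 : q (d + 1) = ((d + 1 : ℤ) : ℝ) / β ∨
            (q (d + 1) = t ∧ (d : ℝ) / β < t ∧ t < ((d + 1 : ℤ) : ℝ) / β) :=
          clamp_right hst hlt
        rcases h2 with h2 | ⟨h2, h3, h4⟩
        · rw [h2, mul_div_cancel₀ _ hβ0.ne']
          simpa using h0Z
        · rw [h2]
          have h5 : ⌊β * t⌋ = d := by
            rw [div_lt_iff₀ hβ0] at h3
            rw [lt_div_iff₀ hβ0] at h4
            push_cast at h4
            exact floor_eq_of_lt (by linarith) (by linarith)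
          have := tmap_mem_orbitSet hk hper ht
          rwa [tmap, h5] at this
      refine (hCle _ hright _ hleft (by nlinarith)).trans (le_of_eq (by ring))
    · rw [heq, Ioo_self, sub_self, mul_zero]
      simp [hM]
  have hsplit : M (Ioo s t) ≤ M (Ioo s t ∩ {z | tmap β z ≠ 1}) := by
    have h1 : Ioo s t ⊆ (Ioo s t ∩ {z | tmap β z ≠ 1}) ∪ {z | tmap β z = 1} := by
      intro z hz
      by_cases h2 : tmap β z = 1
      · exact Or.inr h2
      · exact Or.inl ⟨hz, h2⟩
    have := (hMmono _ _ h1).trans (hMunion _ _)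
    linarith
  have hbound : γ * M (Ioo s t ∩ {z | tmap β z ≠ 1}) ≤ C * β * (t - s) := by
    have h1 := core (Ioo s t ∩ {z | tmap β z ≠ 1}) ((Finset.range N).image fun n : ℕ => (n : ℤ))
      (fun d => Ioo ((d : ℝ) + 1 - β * q (d + 1)) ((d : ℝ) + 1 - β * q d)) (by
        rintro y hy ⟨hy1, hy2⟩
        have h2 := hfloor y hy hy2
        have hfl := Int.floor_le (β * h y)
        have hfl2 := Int.lt_floor_add_one (β * h y)
        have hfl3 : (⌊β * h y⌋ : ℝ) < β * h y := by
          refine lt_of_le_of_ne hfl fun h3 => hy2 ?_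
          rw [tmap, h3]
          ring
        refine ⟨?_, ?_⟩
        · rw [Finset.mem_image]
          refine ⟨⌊γ * y⌋.toNat, ?_, Int.toNat_of_nonneg (hdig0 y hy)⟩
          rw [Finset.mem_range]
          have h3 : (⌊γ * y⌋ : ℝ) < (N : ℤ) := by
            rw [h2]
            push_cast
            have := (hh y hy).2
            nlinarith
          have h4 : ⌊γ * y⌋ < (N : ℤ) := by exact_mod_cast h3
          have := hdig0 y hy
          omega
        · rw [hrec y hy, h2]
          set d := ⌊β * h y⌋
          have h3 : q d < h y := by
            refine max_lt hy1.1 ((min_le_right _ _).trans_lt ?_)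
            rw [div_lt_iff₀ hβ0]
            linarith
          have h4 : h y < q (d + 1) := by
            refine lt_of_lt_of_le (lt_min hy1.2 ?_) (le_max_right _ _)
            rw [lt_div_iff₀ hβ0]
            push_cast
            linarith
          constructor <;> nlinarith)
    rw [Finset.sum_image (fun a _ b _ hab => by exact_mod_cast hab)] at h1
    refine h1.trans ((Finset.sum_le_sum fun (n : ℕ) _ => hpiece (n : ℤ)).trans ?_)
    rw [← Finset.mul_sum]
    have h2 : ∑ n ∈ Finset.range N, (q ((n : ℤ) + 1) - q (n : ℤ)) = q (N : ℤ) - q 0 := by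
      have := Finset.sum_range_sub (fun n : ℕ => q (n : ℤ)) N
      simpa using this
    rw [h2]
    have h3 : q (N : ℤ) = t := by
      have : t ≤ ((N : ℤ) : ℝ) / β := by
        rw [le_div_iff₀ hβ0]
        push_cast
        nlinarith [htI.2]
      simp only [hq]
      rw [min_eq_left this, max_eq_right hst.le]
    have h4 : q 0 = s := by
      simp only [hq, Int.cast_zero, zero_div]
      exact max_eq_left ((min_le_right _ _).trans hsI.1)
    rw [h3, h4]
  have hCzero : C = 0 := by
    have h1 : M (Ioo s t) = C * (t - s) := by
      rw [hC, div_mul_cancel₀ _ hst0.ne']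
    rw [h1] at hsplit
    have h2 : γ * (C * (t - s)) ≤ C * β * (t - s) :=
      (mul_le_mul_of_nonneg_left hsplit hγ0.le).trans hbound
    by_contra hne
    have hCpos : 0 < C := lt_of_le_of_ne hC0 (Ne.symm hne)
    have : 0 < C * (t - s) := by positivity
    nlinarith
  have hfinal : M (Ioo 0 1) ≤ 0 := by
    have := hCle 0 h0Z 1 h1Z one_pos
    rwa [hCzero, zero_mul] at this
  have hall : volume.real Y ≤ 0 := by
    have h1 : Y ⊆ Y ∩ h ⁻¹' (({0} ∪ Ioo 0 1) ∪ {1}) := by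
      intro y hy
      refine ⟨hy, ?_⟩
      have h2 := hh y hy
      rcases h2.1.lt_or_eq with h3 | h3
      · rcases h2.2.lt_or_eq with h4 | h4
        · exact Or.inl (Or.inr ⟨h3, h4⟩)
        · exact Or.inr h4
      · exact Or.inl (Or.inl h3.symm)
    have h2 : volume.real Y ≤ M (({0} ∪ Ioo 0 1) ∪ {1}) := measureReal_mono h1 (hfin _)
    have h3 := hMunion ({0} ∪ Ioo 0 1) {1}
    have h4 := hMunion {0} (Ioo 0 1)
    linarith
  exact (measureReal_eq_zero_iff hYfin).1 (le_antisymm hall measureReal_nonneg)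

theorem countable_preimage_tmap {γ : ℝ} (hγ : 0 < γ) {S : Set ℝ} (hS : S.Countable) :
    (tmap γ ⁻¹' S).Countable := by
  refine Set.Countable.mono ?_
    ((countable_univ (α := ℤ)).prod hS |>.image fun p : ℤ × ℝ => ((p.1 : ℝ) + 1 - p.2) / γ)
  intro y hy
  refine ⟨(⌊γ * y⌋, tmap γ y), ⟨mem_univ _, hy⟩, ?_⟩
  simp only [tmap]
  field_simp
  ring

theorem countable_preimage_tmap_iterate {γ : ℝ} (hγ : 0 < γ) (n : ℕ) :
    {y | (tmap γ)^[n] y = 1}.Countable := by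
  induction n with
  | zero => simp
  | succ n ih =>
    have : {y | (tmap γ)^[n + 1] y = 1} = tmap γ ⁻¹' {y | (tmap γ)^[n] y = 1} := rfl
    rw [this]
    exact countable_preimage_tmap hγ ih

theorem altLt_of_periodic {β γ : ℝ} (hβ : 1 < β) (hβγ : β < γ) {k : ℕ} (hk : 1 ≤ k)
    (hper : (tmap β)^[k] 1 = 1) {b b' : ℕ → ℤ} (hb : Valid β b) (hb' : Valid γ b') :
    AltLt b b' := by
  by_contra hcon
  have hle := altLe_of_not_altLt hcon
  have hγ : 1 < γ := hβ.trans hβγ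
  have hγ0 : 0 < γ := by linarith
  set Y : Set ℝ := {y | y ∈ Icc (0 : ℝ) 1 ∧ ∀ n, (tmap γ)^[n] y ≠ 1} with hY
  have hYT : ∀ y ∈ Y, tmap γ y ∈ Y := fun y hy =>
    ⟨⟨(tmap_pos _ _).le, tmap_le_one _ _⟩, fun n => by
      rw [← Function.iterate_succ_apply]
      exact hy.2 _⟩
  have hYT' : ∀ y ∈ Y, ∀ n, (tmap γ)^[n] y ∈ Y := by
    intro y hy n
    induction n with
    | zero => exact hy
    | succ n ih =>
      rw [Function.iterate_succ_apply']
      exact hYT _ ih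
  have hlt : ∀ y ∈ Y, AltLe (code γ y) b' := by
    intro y hy
    by_contra h1
    have h2 : AltLt b' (code γ y) := by
      by_contra h3
      exact h1 (altLe_of_not_altLt h3)
    have h3 := val_le_add_of_altLe hγ (e := 0) (e' := 0) hb'.1 (hb'.digit_le hγ)
      (code_nonneg hγ0.le hy.1) (code_le hγ0.le hy.1) le_rfl le_rfl
      (fun n => by simpa using hb'.val_shift_mem hγ (n + 1))
      (fun n => by
        rw [shift_code, val_code hγ (tmap_iterate_mem hy.1 _)]
        simpa using tmap_iterate_mem hy.1 (n + 1)) (Or.inl h2)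
    rw [hb'.val_eq hγ, val_code hγ hy.1] at h3
    have h4 := hy.2 0
    simp only [add_zero, zero_div] at h3
    exact h4 (le_antisymm hy.1.2 h3)
  have hzero : volume Y = 0 := by
    refine volume_eq_zero_of_semiconj hβ hβγ hk hper (h := fun y => val β (code γ y))
      (fun y hy => hy.1) (fun y hy => ?_) hYT (fun y hy => ?_)
    · have := val_shift_mem_of_altLe hβ hb (code_nonneg hγ0.le hy.1) (code_le hγ0.le hy.1)
        (fun k => by
          rw [shift_code]
          exact (hlt _ (hYT' y hy k)).trans hle) 0
      simpa using this
    · have := val_rec hβ (code_nonneg hγ0.le hy.1) (code_le hγ0.le hy.1)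
      rw [shift_code] at this
      exact this
  have hcount : (⋃ n, {y | (tmap γ)^[n] y = 1}).Countable :=
    countable_iUnion fun n => countable_preimage_tmap_iterate hγ0 n
  have h1 : volume (Icc (0 : ℝ) 1) ≤ 0 := by
    refine (measure_mono (t := Y ∪ ⋃ n, {y | (tmap γ)^[n] y = 1}) ?_).trans
      ((measure_union_le _ _).trans ?_)
    · intro y hy
      by_cases h : ∃ n, (tmap γ)^[n] y = 1
      · exact Or.inr (mem_iUnion.2 h)
      · push Not at h
        exact Or.inl ⟨hy, h⟩
    · rw [hzero, hcount.measure_zero, add_zero]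
  rw [Real.volume_Icc] at h1
  norm_num at h1

/-! ### Density of the parameters with a periodic orbit of `1`, and strict monotonicity -/

theorem floor_eq_of_forall_ne_int {f : ℝ → ℝ} (hf : Continuous f) {S : Set ℝ}
    (hS : IsPreconnected S) (hne : ∀ x ∈ S, ∀ e : ℤ, f x ≠ e) {x y : ℝ} (hx : x ∈ S)
    (hy : y ∈ S) : ⌊f x⌋ = ⌊f y⌋ := by
  have aux : ∀ x ∈ S, ∀ y ∈ S, ⌊f y⌋ ≤ ⌊f x⌋ := by
    intro x hx y hy
    by_contra! hlt
    have h1 : f x < ⌊f y⌋ := Int.floor_lt.1 hlt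
    obtain ⟨z, hz, hz2⟩ := hS.intermediate_value hx hy hf.continuousOn ⟨h1.le, Int.floor_le _⟩
    exact hne z hz _ hz2
  exact le_antisymm (aux y hy x hx) (aux x hx y hy)

theorem mul_iterate_ne_int {β : ℝ} (h : ∀ k, 1 ≤ k → (tmap β)^[k] 1 ≠ 1) (n : ℕ) (e : ℤ) :
    β * (tmap β)^[n] 1 ≠ e := by
  intro he
  refine h (n + 1) (by omega) ?_
  rw [Function.iterate_succ_apply', tmap, he, Int.floor_intCast]
  ring

theorem iterate_eq_orb {β : ℝ} {s : ℕ → ℤ} {n : ℕ} (h : ∀ i < n, code β 1 i = s i) :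
    (tmap β)^[n] 1 = orb β 1 s n := by
  rw [← orb_code, orb_congr β 1 h]

theorem not_val_eq_one_of_mem_Ioo {β γ : ℝ} (hβ : 1 < β) (hβγ : β < γ) {s : ℕ → ℤ} {N : ℝ}
    (hs0 : ∀ n, 0 ≤ s n) (hsN : ∀ n, (s n : ℝ) ≤ N) : ¬ ∀ δ ∈ Ioo β γ, val δ s = 1 := by
  intro h
  set p := FormalMultilinearSeries.ofScalars ℝ (fun n : ℕ => (s n : ℝ) + 1) with hp
  have hrad : (1 : ENNReal) ≤ p.radius := by
    have := p.le_radius_of_bound (N + 1) (r := 1) (fun n => by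
      rw [hp, FormalMultilinearSeries.ofScalars_norm, NNReal.coe_one, one_pow, mul_one,
        Real.norm_of_nonneg (by have : (0 : ℝ) ≤ s n := by exact_mod_cast hs0 n
                                linarith)]
      linarith [hsN n])
    simpa using this
  have hana : AnalyticOnNhd ℝ (fun w => w * p.sum w) (Metric.ball 0 1) := by
    have h1 := (p.hasFPowerSeriesOnBall (lt_of_lt_of_le one_pos hrad)).analyticOnNhd
    have h2 : AnalyticOnNhd ℝ p.sum (Metric.ball 0 1) := by
      refine h1.mono ?_
      have h3 := Metric.eball_subset_eball (x := (0 : ℝ)) hrad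
      rwa [← ENNReal.ofReal_one, Metric.eball_ofReal] at h3
    exact analyticOnNhd_id.mul h2
  have hval : ∀ δ : ℝ, val δ s = -((-δ)⁻¹ * p.sum (-δ)⁻¹) := by
    intro δ
    have h1 : p.sum (-δ)⁻¹ = ∑' n : ℕ, ((s n : ℝ) + 1) * ((-δ)⁻¹) ^ n := by
      have := FormalMultilinearSeries.ofScalars_sum_eq (fun n : ℕ => (s n : ℝ) + 1) ((-δ)⁻¹)
      simpa [hp, FormalMultilinearSeries.ofScalarsSum] using this
    rw [h1, ← tsum_mul_left, val]
    congr 1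
    refine tsum_congr fun n => ?_
    rw [div_eq_mul_inv, ← inv_pow, pow_succ]
    ring
  obtain ⟨δ, hδ⟩ := exists_between hβγ
  have hδ0 : -δ ≠ 0 := by linarith [hδ.1]
  have hmem : (-δ)⁻¹ ∈ Metric.ball (0 : ℝ) 1 := by
    rw [mem_ball_zero_iff, norm_inv, norm_neg, Real.norm_of_nonneg (by linarith [hδ.1])]
    exact inv_lt_one_of_one_lt₀ (hβ.trans hδ.1)
  have hev : (fun w => w * p.sum w) =ᶠ[nhds (-δ)⁻¹] fun _ => -1 := by
    have hcont : Tendsto (fun w : ℝ => -w⁻¹) (nhds (-δ)⁻¹) (nhds δ) := by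
      have := (tendsto_inv₀ (inv_ne_zero hδ0)).neg
      simpa using this
    filter_upwards [hcont (Ioo_mem_nhds hδ.1 hδ.2)] with w hw
    have h1 := h _ hw
    rw [hval, neg_neg, inv_inv] at h1
    linarith
  have h0 := hana.eqOn_of_preconnected_of_eventuallyEq analyticOnNhd_const
    (convex_ball (0 : ℝ) 1).isPreconnected hmem hev (Metric.mem_ball_self one_pos)
  norm_num at h0

theorem exists_periodic {β γ : ℝ} (hβ : 1 < β) (hβγ : β < γ) :
    ∃ δ ∈ Ioo β γ, ∃ k, 1 ≤ k ∧ (tmap δ)^[k] 1 = 1 := by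
  by_contra! hcon
  obtain ⟨δ₀, hδ₀⟩ := exists_between hβγ
  have hcode : ∀ n, ∀ i < n, ∀ δ ∈ Ioo β γ, code δ 1 i = code δ₀ 1 i := by
    intro n
    induction n with
    | zero => intro i hi; omega
    | succ n ih =>
      intro i hi δ hδ
      rcases Nat.lt_succ_iff_lt_or_eq.1 hi with h1 | rfl
      · exact ih i h1 δ hδ
      · have hit : ∀ x ∈ Ioo β γ, (tmap x)^[i] 1 = orb x 1 (code δ₀ 1) i := fun x hx =>
          iterate_eq_orb fun l hl => ih l hl x hx
        have := floor_eq_of_forall_ne_int (f := fun x => x * orb x 1 (code δ₀ 1) i)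
          (continuous_id.mul (continuous_orb 1 _ i)) isPreconnected_Ioo (fun x hx e => by
            rw [← hit x hx]
            exact mul_iterate_ne_int (hcon x hx) i e) hδ hδ₀
        rw [code, code, hit δ hδ, hit δ₀ hδ₀]
        exact this
  have hδ₀1 : 1 < δ₀ := hβ.trans hδ₀.1
  refine not_val_eq_one_of_mem_Ioo hβ hβγ (valid_code hδ₀1).1
    ((valid_code hδ₀1).digit_le hδ₀1) fun δ hδ => ?_
  have : code δ₀ 1 = code δ 1 := funext fun i => (hcode (i + 1) i (Nat.lt_succ_self i) δ hδ).symm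
  rw [this, val_code (hβ.trans hδ.1) one_mem_Icc]

theorem eventually_code_eq {β : ℝ} (h : ∀ k, 1 ≤ k → (tmap β)^[k] 1 ≠ 1) (K : ℕ) :
    ∀ᶠ γ in nhds β, ∀ i < K, code γ 1 i = code β 1 i := by
  induction K with
  | zero => exact Eventually.of_forall fun _ i hi => absurd hi (Nat.not_lt_zero i)
  | succ K ih =>
    have hc : Continuous fun x => x * orb x 1 (code β 1) K :=
      continuous_id.mul (continuous_orb 1 _ K)
    have hβ : β * orb β 1 (code β 1) K = β * (tmap β)^[K] 1 := by rw [orb_code]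
    have hmem : β * orb β 1 (code β 1) K ∈
        Ioo (code β 1 K : ℝ) ((code β 1 K : ℝ) + 1) := by
      rw [hβ]
      exact ⟨lt_of_le_of_ne (Int.floor_le _) (mul_iterate_ne_int h K _).symm,
        Int.lt_floor_add_one _⟩
    filter_upwards [ih, hc.continuousAt.preimage_mem_nhds (isOpen_Ioo.mem_nhds hmem)] with γ h1 h2
    intro i hi
    rcases Nat.lt_succ_iff_lt_or_eq.1 hi with h3 | rfl
    · exact h1 i h3
    · have h4 : γ * orb γ 1 (code β 1) i ∈ Ioo (code β 1 i : ℝ) ((code β 1 i : ℝ) + 1) := h2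
      rw [← iterate_eq_orb h1] at h4
      exact floor_eq_of_lt h4.1.le h4.2

theorem eq_code_of_not_periodic {β : ℝ} (h : ∀ k, 1 ≤ k → (tmap β)^[k] 1 ≠ 1) {b : ℕ → ℤ}
    (hb : Valid β b) : b = code β 1 := by
  by_contra hne
  obtain ⟨j, hj, hne⟩ := exists_first_ne hne
  have h1 := orb_code β 1 (j + 1)
  rcases orb_of_first_ne hj hne (hb.2 _)
    (by rw [h1]; exact tmap_iterate_mem one_mem_Icc _) with h2 | h2
  · rw [h1, Function.iterate_succ_apply'] at h2
    exact (tmap_pos _ _).ne' h2.2.1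
  · rw [h1] at h2
    exact h _ (by omega) h2.2.1

/-- Valid sequences increase strictly with the parameter. -/
theorem altLt_of_lt {β γ : ℝ} (hβ : 1 < β) (hβγ : β < γ) {b b' : ℕ → ℤ} (hb : Valid β b)
    (hb' : Valid γ b') : AltLt b b' := by
  by_cases hper : ∃ k, 1 ≤ k ∧ (tmap β)^[k] 1 = 1
  · obtain ⟨k, hk, hper⟩ := hper
    exact altLt_of_periodic hβ hβγ hk hper hb hb'
  · push Not at hper
    obtain ⟨γ₁, hγ₁, k, hk, hk1⟩ := exists_periodic hβ hβγ
    have hγ₁1 : 1 < γ₁ := hβ.trans hγ₁.1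
    have h1 := altLt_of_periodic hγ₁1 hγ₁.2 hk hk1 (valid_code hγ₁1) hb'
    refine AltLe.trans_lt (altLe_of_not_altLt fun hlt => ?_) h1
    rw [eq_code_of_not_periodic hper hb] at hlt
    obtain ⟨K, hK⟩ := hlt.exists_agreement
    obtain ⟨u, hu, huK⟩ := exists_Ico_subset_of_mem_nhds' (eventually_code_eq hper (K + 1)) hγ₁.1
    obtain ⟨γ₂, hγ₂, m, hm, hm1⟩ := exists_periodic hβ hu.1
    have h2 := altLt_of_periodic (hβ.trans hγ₂.1) (hγ₂.2.trans_le hu.2) hm hm1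
      (valid_code (hβ.trans hγ₂.1)) (valid_code hγ₁1)
    have h3 := hK (code γ₁ 1) (code γ₂ 1) (fun _ _ => rfl)
      (fun i hi => huK ⟨hγ₂.1.le, hγ₂.2⟩ i (Nat.lt_succ_of_le hi))
    exact altLt_irrefl _ (h2.trans h3)

/-! ### Parameters close to `1` and the sequence `uSeq` -/

/-- Two affine branches, both decreasing, of slopes `-p` and `-q`. -/
noncomputable def branch (q p : ℝ) (c : ℕ) (y : ℝ) : ℝ :=
  if c = 1 then 1 + p / q - p * y else 1 - q * y

/-- The word `l` is an itinerary of `y`, with all images in `(0, 1)`. -/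
def Itinerary (q p : ℝ) : List ℕ → ℝ → Prop
  | [], _ => True
  | c :: l, y => branch q p c y ∈ Ioo (0 : ℝ) 1 ∧ Itinerary q p l (branch q p c y)

theorem itinerary_flatMap {q p : ℝ} (hq : 1 < q) (hp : 1 < p) (h1 : p / q * (q - 1) < 1)
    (h2 : (q - 1) * (p - 1) < 1) {l : List ℕ} {z : ℝ} (hz : z ∈ Ioc (0 : ℝ) 1)
    (h : Itinerary p (p * q ^ 2) l z) :
    Itinerary q p (l.flatMap phiW) (1 / q + (1 - 1 / q) * z) := by
  have hq0 : 0 < q := by linarith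
  have hp0 : 0 < p := by linarith
  have hqi : 1 / q < 1 := (div_lt_one hq0).2 hq
  have hqi0 : 0 < 1 / q := by positivity
  have hpq : 0 < p / q * (q - 1) := mul_pos (by positivity) (by linarith)
  induction l generalizing z with
  | nil => trivial
  | cons c l ih =>
    obtain ⟨hz0, hz1⟩ := hz
    obtain ⟨hc, hl⟩ := h
    have ih' := ih ⟨hc.1, hc.2.le⟩ hl
    have hψ : 1 / q + (1 - 1 / q) * branch p (p * q ^ 2) c z ∈ Ioo (0 : ℝ) 1 := by
      have h3 : 0 < 1 - 1 / q := by linarith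
      constructor
      · have := mul_pos h3 hc.1
        linarith
      · nlinarith [hc.2]
    have hstep : branch q p 1 (1 / q + (1 - 1 / q) * z) = 1 - p / q * (q - 1) * z := by
      rw [branch, if_pos rfl]
      field_simp
      ring
    have hstep01 : 1 - p / q * (q - 1) * z ∈ Ioo (0 : ℝ) 1 := by
      have := mul_pos hpq hz0
      have := mul_le_of_le_one_right hpq.le hz1
      exact ⟨by linarith, by linarith⟩
    by_cases hc1 : c = 1
    · subst hc1
      have hbr : branch p (p * q ^ 2) 1 z = 1 + q ^ 2 - p * q ^ 2 * z := by
        rw [branch, if_pos rfl]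
        field_simp
      have hpz : 1 < p * z := by
        have := hc.2
        rw [hbr] at this
        have hq2 : 0 < q ^ 2 := by positivity
        nlinarith
      have hstep2 : branch q p 0 (1 - p / q * (q - 1) * z) = (q - 1) * (p * z - 1) := by
        rw [branch, if_neg (by norm_num)]
        field_simp
        ring
      have hstep3 : branch q p 0 ((q - 1) * (p * z - 1)) =
          1 / q + (1 - 1 / q) * branch p (p * q ^ 2) 1 z := by
        rw [hbr, branch, if_neg (by norm_num)]
        field_simp
        ring
      have h01 : (q - 1) * (p * z - 1) ∈ Ioo (0 : ℝ) 1 := by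
        constructor
        · exact mul_pos (by linarith) (by linarith)
        · have : p * z ≤ p := mul_le_of_le_one_right hp0.le hz1
          nlinarith
      simp only [List.flatMap_cons, phiW, List.cons_append, List.nil_append, Itinerary]
      rw [hstep, hstep2, hstep3]
      exact ⟨hstep01, h01, hψ, ih'⟩
    · have hphi : phiW c = [1] := by
        match c with
        | 0 => rfl
        | 1 => exact absurd rfl hc1
        | n + 2 => rfl
      have hψeq : 1 - p / q * (q - 1) * z = 1 / q + (1 - 1 / q) * branch p (p * q ^ 2) c z := by
        rw [branch, if_neg hc1]
        field_simp
        ring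
      simp only [List.flatMap_cons, hphi, List.cons_append, List.nil_append, Itinerary]
      rw [hstep]
      refine ⟨hstep01, ?_⟩
      rw [hψeq]
      exact ih'

theorem exists_itinerary_uWord (n : ℕ) :
    ∃ ε : ℝ, 0 < ε ∧ ∀ q p : ℝ, q ∈ Ioo 1 (1 + ε) → p ∈ Ioo 1 (1 + ε) →
      Itinerary q p (uWord n) 1 := by
  have hsmall : ∀ q p : ℝ, q ∈ Ioo 1 (1 + 1 / 2) → p ∈ Ioo 1 (1 + 1 / 2) →
      p / q * (q - 1) < 1 := by
    rintro q p ⟨hq1, hq2⟩ ⟨hp1, hp2⟩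
    rw [div_mul_eq_mul_div, div_lt_one (by linarith)]
    nlinarith
  induction n with
  | zero =>
    refine ⟨1 / 2, by norm_num, fun q p hq hp => ?_⟩
    have h1 := hsmall q p hq hp
    have hq0 : 0 < q := by linarith [hq.1]
    have hp0 : 0 < p := by linarith [hp.1]
    have h2 : 0 < p / q * (q - 1) := mul_pos (by positivity) (by linarith [hq.1])
    have h3 : 1 + p / q - p * 1 = 1 - p / q * (q - 1) := by
      field_simp
      ring
    refine ⟨?_, trivial⟩
    rw [branch, if_pos rfl, h3]
    exact ⟨by linarith, by linarith⟩
  | succ n ih =>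
    obtain ⟨ε, hε, ih⟩ := ih
    refine ⟨min (1 / 2) (ε / 7), by positivity, ?_⟩
    rintro q p ⟨hq1, hq2⟩ ⟨hp1, hp2⟩
    set η := min (1 / 2) (ε / 7) with hη
    have hη0 : 0 < η := by positivity
    have hη1 : η ≤ 1 / 2 := min_le_left _ _
    have hη2 : η ≤ ε / 7 := min_le_right _ _
    have hpq : p * q ^ 2 < 1 + ε := by
      have h1 : p * q ^ 2 < (1 + η) * (1 + η) ^ 2 := by gcongr
      have h2 : (1 + η) * (1 + η) ^ 2 ≤ 1 + 7 * η := by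
        nlinarith [mul_pos hη0 hη0]
      linarith
    have hpq1 : 1 < p * q ^ 2 := one_lt_mul_of_lt_of_le hp1 (one_le_pow₀ hq1.le)
    have h := itinerary_flatMap hq1 hp1
      (hsmall q p ⟨hq1, by linarith⟩ ⟨hp1, by linarith⟩) (by nlinarith)
      (z := 1) ⟨one_pos, le_rfl⟩ (ih p (p * q ^ 2) ⟨hp1, by linarith⟩ ⟨hpq1, hpq⟩)
    have h1 : 1 / q + (1 - 1 / q) * 1 = 1 := by ring
    rw [h1] at h
    exact h

theorem code_eq_of_itinerary {β : ℝ} (hβ : 1 < β) {l : List ℕ} (hl : ∀ c ∈ l, c = 0 ∨ c = 1)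
    {y : ℝ} (h : Itinerary β β l y) {i : ℕ} (hi : i < l.length) :
    code β y i = ((l.getD i 0 : ℕ) : ℤ) := by
  induction l generalizing y i with
  | nil => exact absurd hi (Nat.not_lt_zero _)
  | cons c l ih =>
    obtain ⟨hc, hl'⟩ := h
    have hbr : branch β β c y = (c : ℝ) + 1 - β * y := by
      rcases hl c (by simp) with rfl | rfl
      · simp [branch]
      · rw [branch, if_pos rfl, div_self (by linarith)]
        norm_num
    rw [hbr] at hc hl'
    have hfl : ⌊β * y⌋ = (c : ℤ) :=
      floor_eq_of_lt (by push_cast; linarith [hc.2]) (by push_cast; linarith [hc.1])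
    cases i with
    | zero => simpa [code] using hfl
    | succ i =>
      have hT : tmap β y = (c : ℝ) + 1 - β * y := by
        rw [tmap, hfl]
        push_cast
        rfl
      have h1 := ih (fun c hc => hl c (by simp [hc])) hl' (i := i) (by simpa using hi)
      rw [← hT] at h1
      simpa [code] using h1

theorem phiW_mem (c d : ℕ) (h : d ∈ phiW c) : d = 0 ∨ d = 1 := by
  match c with
  | 0 => simp [phiW] at h; omega
  | 1 => simp [phiW] at h; omega
  | n + 2 => simp [phiW] at h; omega

theorem uWord_mem (n c : ℕ) (h : c ∈ uWord n) : c = 0 ∨ c = 1 := by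
  cases n with
  | zero => simp [uWord] at h; omega
  | succ n =>
    obtain ⟨d, -, hd⟩ := List.mem_flatMap.1 h
    exact phiW_mem d c hd

theorem length_le_length_flatMap_phiW (l : List ℕ) : l.length ≤ (l.flatMap phiW).length := by
  induction l with
  | nil => simp
  | cons c l ih =>
    have : 1 ≤ (phiW c).length := by
      match c with
      | 0 => simp [phiW]
      | 1 => simp [phiW]
      | n + 2 => simp [phiW]
    simp only [List.flatMap_cons, List.length_append, List.length_cons]
    omega

theorem lt_length_uWord (n : ℕ) : n < (uWord n).length ∧ ∃ l, uWord n = 1 :: l := by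
  induction n with
  | zero => simp [uWord]
  | succ n ih =>
    obtain ⟨h1, l, hl⟩ := ih
    rw [hl] at h1
    have h2 := length_le_length_flatMap_phiW l
    rw [uWord, hl]
    simp only [List.length_cons] at h1
    refine ⟨?_, ?_⟩
    · simp only [List.flatMap_cons, List.length_append, phiW, List.length_cons, List.length_nil]
      omega
    · simp [phiW]

theorem eventually_code_eq_uSeq (K : ℕ) :
    ∀ᶠ γ in nhdsWithin (1 : ℝ) (Ioi 1), ∀ i ∈ Iio K, code γ 1 i = uSeq i := by
  rw [eventually_all_finite (finite_Iio K)]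
  intro i _
  obtain ⟨ε, hε, h⟩ := exists_itinerary_uWord (i + 1)
  filter_upwards [Ioo_mem_nhdsGT (show (1 : ℝ) < 1 + ε by linarith)] with γ hγ
  have hlen := (lt_length_uWord (i + 1)).1
  exact code_eq_of_itinerary hγ.1 (uWord_mem (i + 1)) (h γ γ hγ hγ) (by omega)

/-- Valid sequences are larger than `uSeq`. -/
theorem uSeq_altLt {β : ℝ} (hβ : 1 < β) {b : ℕ → ℤ} (hb : Valid β b) : AltLt uSeq b := by
  obtain ⟨γ, hγ⟩ := exists_between hβ
  refine AltLe.trans_lt (altLe_of_not_altLt fun hlt => ?_)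
    (altLt_of_lt hγ.1 hγ.2 (valid_code hγ.1) hb)
  obtain ⟨K, hK⟩ := hlt.exists_agreement
  obtain ⟨δ, hδ1, hδ2⟩ := ((eventually_code_eq_uSeq (K + 1)).and (Ioo_mem_nhdsGT hγ.1)).exists
  have h1 := altLt_of_lt hδ2.1 hδ2.2 (valid_code hδ2.1) (valid_code hγ.1)
  exact altLt_irrefl _ (h1.trans (hK (code γ 1) (code δ 1) (fun _ _ => rfl)
    fun i hi => hδ1 i (Nat.lt_succ_of_le hi)))

/-! ### Existence of a parameter -/

theorem _root_.AltLe.head_le {s t : ℕ → ℤ} (h : AltLe s t) : s 0 ≤ t 0 := by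
  rcases h with ⟨k, hk, hlt⟩ | rfl
  · rcases Nat.eq_zero_or_pos k with rfl | hpos
    · simp at hlt
      exact hlt.le
    · exact (hk 0 hpos).le
  · exact le_rfl

theorem _root_.CondG.shift_le {c : ℕ → ℤ} (hG : CondG c) (k : ℕ) : AltLe (shift c k) c := by
  rcases Nat.eq_zero_or_pos k with rfl | hk
  · rw [shift_zero]
    exact Or.inr rfl
  · have h : shift c k = fun n => c (n + k) := by
      funext n
      rw [shift_apply, add_comm]
    rw [h]
    exact hG k hk

theorem _root_.CondG.le_head {c : ℕ → ℤ} (hG : CondG c) (k : ℕ) : c k ≤ c 0 := by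
  have := (hG.shift_le k).head_le
  simpa [shift_apply] using this

theorem abs_val_sub_val_le {β γ : ℝ} (hβ : 1 < β) (hγ : 1 < γ) {c : ℕ → ℤ} {N B : ℝ}
    (hc0 : ∀ n, 0 ≤ c n) (hcN : ∀ n, (c n : ℝ) ≤ N) (hB : ∀ k, |val γ (shift c k)| ≤ B) (k : ℕ) :
    |val γ (shift c k) - val β (shift c k)| ≤ |γ - β| * B / (β - 1) := by
  have hβ0 : 0 < β := by linarith
  have hrec : ∀ δ : ℝ, 1 < δ → ∀ k,
      val δ (shift c (k + 1)) = (c k : ℝ) + 1 - δ * val δ (shift c k) := by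
    intro δ hδ k
    rw [← orb_val hδ hc0 hcN, ← orb_val hδ hc0 hcN, orb_succ]
  refine le_of_contraction (e := fun k => |val γ (shift c k) - val β (shift c k)|)
    (M := B + (N + 1) / (β - 1)) hβ (fun k => ?_) (fun k => ⟨k + 1, ?_⟩) k
  · exact (abs_sub _ _).trans (add_le_add (hB k)
      (abs_val_le hβ (s := shift c k) (fun m => hc0 _) (fun m => hcN _)))
  · rw [le_div_iff₀ hβ0, hrec γ hγ, hrec β hβ]
    have h1 : (val γ (shift c k) - val β (shift c k)) * β =
        -(((c k : ℝ) + 1 - γ * val γ (shift c k) - ((c k : ℝ) + 1 - β * val β (shift c k))) +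
          (γ - β) * val γ (shift c k)) := by ring
    calc |val γ (shift c k) - val β (shift c k)| * β
        = |(val γ (shift c k) - val β (shift c k)) * β| := by rw [abs_mul, abs_of_pos hβ0]
      _ ≤ _ := by
        rw [h1, abs_neg]
        refine (abs_add_le _ _).trans (add_le_add le_rfl ?_)
        rw [abs_mul]
        exact mul_le_mul_of_nonneg_left (hB k) (abs_nonneg _)

theorem exists_valid {c : ℕ → ℤ} (hc0 : ∀ n, 0 ≤ c n) (hG : CondG c) (hL : CondL c) :
    ∃ γ : ℝ, 1 < γ ∧ Valid γ c := by
  have hcN : ∀ n, (c n : ℝ) ≤ (c 0 : ℝ) := fun n => by exact_mod_cast hG.le_head n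
  set S : Set ℝ := {γ | 1 < γ ∧ AltLe (code γ 1) c} with hS
  have hSne : S.Nonempty := by
    obtain ⟨K, hK⟩ := AltLt.exists_agreement hL
    obtain ⟨δ, hδ1, hδ2⟩ :=
      ((eventually_code_eq_uSeq (K + 1)).and (self_mem_nhdsWithin (s := Ioi (1 : ℝ)))).exists
    exact ⟨δ, hδ2, Or.inl (hK _ _ (fun i hi => hδ1 i (Nat.lt_succ_of_le hi)) fun _ _ => rfl)⟩
  have hSbdd : BddAbove S := by
    refine ⟨(c 0 : ℝ) + 1, fun γ hγ => ?_⟩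
    have h1 := hγ.2.head_le
    rw [code_zero, mul_one] at h1
    have h2 := Int.lt_floor_add_one γ
    have h3 : (⌊γ⌋ : ℝ) ≤ c 0 := by exact_mod_cast h1
    linarith
  set g := sSup S with hg
  have hg1 : 1 < g := by
    obtain ⟨γ, hγ⟩ := hSne
    exact lt_of_lt_of_le hγ.1 (le_csSup hSbdd hγ)
  have hg10 : 0 < g - 1 := by linarith
  have habove : ∀ γ, g < γ → ∀ k, val γ (shift c k) ∈ Icc (0 : ℝ) 1 := by
    intro γ hγ k
    have hγ1 : 1 < γ := hg1.trans hγ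
    refine val_shift_mem_of_altLe hγ1 (valid_code hγ1) hc0 hcN (fun k => ?_) k
    refine (hG.shift_le k).trans ?_
    refine altLe_of_not_altLt fun h => ?_
    exact absurd (le_csSup hSbdd ⟨hγ1, Or.inl h⟩) (not_le.2 hγ)
  have hval : ∀ k, val g (shift c k) ∈ Icc (0 : ℝ) 1 := by
    intro k
    have key : ∀ ε : ℝ, 0 < ε → -ε ≤ val g (shift c k) ∧ val g (shift c k) ≤ 1 + ε := by
      intro ε hε
      have hlt : g < g + ε * (g - 1) := by
        have : 0 < ε * (g - 1) := by positivity
        linarith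
      have h1 := abs_val_sub_val_le hg1 (hg1.trans hlt) hc0 hcN (B := 1) (fun k => by
        have := habove _ hlt k
        exact abs_le.2 ⟨by linarith [this.1], this.2⟩) k
      have h2 : |g + ε * (g - 1) - g| * 1 / (g - 1) = ε := by
        rw [add_sub_cancel_left, abs_of_pos (by positivity), mul_one, mul_div_cancel_right₀]
        exact hg10.ne'
      rw [h2, abs_le] at h1
      have h3 := habove _ hlt k
      exact ⟨by linarith [h1.2, h3.1], by linarith [h1.1, h3.2]⟩
    constructor
    · exact le_of_forall_pos_le_add fun ε hε => by linarith [(key ε hε).1]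
    · exact le_of_forall_pos_le_add fun ε hε => (key ε hε).2
  refine ⟨g, hg1, valid_of_val hg1 hc0 hcN ?_ hval⟩
  have hval0 := hval 0
  rw [shift_zero] at hval0
  refine le_antisymm hval0.2 ?_
  by_contra! hlt
  set η := 1 - val g c with hη
  have hη0 : 0 < η := by linarith
  obtain ⟨γ, hγ, hγlt⟩ := exists_lt_of_lt_csSup hSne
    (show max ((1 + g) / 2) (g - η * (g - 1) / 8) < g from max_lt (by linarith) (by
      have : 0 < η * (g - 1) := by positivity
      linarith))
  have hγg : γ ≤ g := le_csSup hSbdd hγ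
  have h1 := (le_max_left _ _).trans_lt hγlt
  have h2 := (le_max_right _ _).trans_lt hγlt
  have hγ10 : 0 < γ - 1 := by linarith
  set e := |g - γ| * 1 / (γ - 1) with he
  have he0 : 0 ≤ e := by positivity
  have heη : e ≤ η / 4 := by
    rw [he, div_le_iff₀ hγ10, abs_of_nonneg (by linarith)]
    nlinarith
  have hclose := abs_val_sub_val_le hγ.1 hg1 hc0 hcN (B := 1) (fun k => by
    have := hval k
    exact abs_le.2 ⟨by linarith [this.1], this.2⟩)
  rw [← he] at hclose
  have h3 := val_le_add_of_altLe hγ.1 (e := 0) (e' := e) (valid_code hγ.1).1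
    ((valid_code hγ.1).digit_le hγ.1) hc0 hcN le_rfl he0
    (fun n => by simpa using (valid_code hγ.1).val_shift_mem hγ.1 (n + 1))
    (fun n => by
      have h4 := abs_le.1 (hclose (n + 1))
      have h5 := hval (n + 1)
      exact ⟨by linarith [h4.2, h5.1], by linarith [h4.1, h5.2]⟩) hγ.2
  rw [(valid_code hγ.1).val_eq hγ.1, zero_add] at h3
  have h6 := abs_le.1 (hclose 0)
  rw [shift_zero] at h6
  have h7 : e / γ ≤ e := div_le_self he0 hγ.1.le
  linarith [h6.1]

/-! ### Infinite concatenations -/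

theorem getD_map_range (a : ℕ → ℤ) {n i : ℕ} (h : i < n) :
    ((List.range n).map a).getD i 0 = a i := by
  simp [List.getD_eq_getElem?_getD, h]

theorem getD_map_range_append (a : ℕ → ℤ) (l : List ℤ) {n i : ℕ} (h : i < n) :
    ((List.range n).map a ++ l).getD i 0 = a i := by
  rw [List.getD_append _ _ _ _ (by simpa using h), getD_map_range a h]

theorem getD_map_range_append_right (a : ℕ → ℤ) (l : List ℤ) (n i : ℕ) :
    ((List.range n).map a ++ l).getD (n + i) 0 = l.getD i 0 := by
  rw [List.getD_append_right _ _ _ _ (by simp)]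
  simp

theorem flatten_map_range_succ (w : ℕ → List ℤ) (N : ℕ) :
    ((List.range (N + 1)).map w).flatten = ((List.range N).map w).flatten ++ w N := by
  simp [List.range_succ]

theorem _root_.IsInfConcat.exists_positions {S : Set (List ℤ)} {a : ℕ → ℤ}
    (h : IsInfConcat S a) : ∃ (w : ℕ → List ℤ) (pos : ℕ → ℕ), pos 0 = 0 ∧ ∀ N, w N ∈ S ∧
      pos (N + 1) = pos N + (w N).length ∧
      ∀ i < (w N).length, (w N).getD i 0 = a (pos N + i) := by
  obtain ⟨w, hw, h⟩ := h
  refine ⟨w, fun N => (((List.range N).map w).flatten).length, by simp, fun N => ⟨hw N, ?_, ?_⟩⟩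
  · simp only [flatten_map_range_succ, List.length_append]
  · intro i hi
    have h1 := h (N + 1) ((((List.range N).map w).flatten).length + i)
    rw [flatten_map_range_succ, List.length_append] at h1
    rw [← h1 (by omega), List.getD_append_right _ _ _ _ (by omega), Nat.add_sub_cancel_left]

theorem isInfConcat_of_positions {S : Set (List ℤ)} {a : ℕ → ℤ} (w : ℕ → List ℤ) (pos : ℕ → ℕ)
    (h0 : pos 0 = 0) (h : ∀ N, w N ∈ S ∧ pos (N + 1) = pos N + (w N).length ∧
      ∀ i < (w N).length, (w N).getD i 0 = a (pos N + i)) : IsInfConcat S a := by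
  have hlen : ∀ N, (((List.range N).map w).flatten).length = pos N := by
    intro N
    induction N with
    | zero => simp [h0]
    | succ N ih => rw [flatten_map_range_succ, List.length_append, ih, (h N).2.1]
  refine ⟨w, fun N => (h N).1, fun N => ?_⟩
  induction N with
  | zero =>
    intro i hi
    exact absurd hi (by simp)
  | succ N ih =>
    intro i hi
    rw [flatten_map_range_succ] at hi ⊢
    rcases Nat.lt_or_ge i (((List.range N).map w).flatten).length with h1 | h1
    · rw [List.getD_append _ _ _ _ h1]
      exact ih i h1
    · rw [List.getD_append_right _ _ _ _ h1]
      rw [List.length_append] at hi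
      have := (h N).2.2 (i - (((List.range N).map w).flatten).length) (by omega)
      rw [this, hlen]
      rw [hlen] at h1
      congr 1
      omega

theorem isInfConcat_of_step {S : Set (List ℤ)} {a : ℕ → ℤ} (Q : ℕ → Prop) (h0 : Q 0)
    (h : ∀ n, Q n → ∃ w ∈ S, (∀ i < w.length, w.getD i 0 = a (n + i)) ∧ Q (n + w.length)) :
    IsInfConcat S a := by
  choose! w hw hd hQ using h
  set pos : ℕ → ℕ := fun N => (fun n => n + (w n).length)^[N] 0 with hpos
  have hsucc : ∀ N, pos (N + 1) = pos N + (w (pos N)).length := fun N => by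
    simp only [hpos]
    rw [Function.iterate_succ_apply']
  have hQpos : ∀ N, Q (pos N) := by
    intro N
    induction N with
    | zero => exact h0
    | succ N ih =>
      rw [hsucc]
      exact hQ _ ih
  exact isInfConcat_of_positions (fun N => w (pos N)) pos rfl fun N =>
    ⟨hw _ (hQpos N), hsucc N, hd _ (hQpos N)⟩

theorem valid_of_blocks {γ : ℝ} {a : ℕ → ℤ} (ha : ∀ n, 0 ≤ a n) {pos L : ℕ → ℕ}
    (h0 : pos 0 = 0) (hpos : ∀ N, pos (N + 1) = pos N + L N) (hL : ∀ N, 1 ≤ L N)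
    (h : ∀ N, orb γ 1 a (pos N) = 1 →
      (∀ t < L N, orb γ 1 a (pos N + t) ∈ Icc (0 : ℝ) 1) ∧ orb γ 1 a (pos N + L N) = 1) :
    Valid γ a := by
  refine ⟨ha, ?_⟩
  have hone : ∀ N, orb γ 1 a (pos N) = 1 := by
    intro N
    induction N with
    | zero => rw [h0]; rfl
    | succ N ih => rw [hpos]; exact (h N ih).2
  have hall : ∀ N, N ≤ pos N ∧ ∀ m < pos N, orb γ 1 a m ∈ Icc (0 : ℝ) 1 := by
    intro N
    induction N with
    | zero =>
      rw [h0]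
      exact ⟨le_rfl, fun m hm => absurd hm (Nat.not_lt_zero m)⟩
    | succ N ih =>
      have h1 := hL N
      rw [hpos]
      refine ⟨by omega, fun m hm => ?_⟩
      rcases Nat.lt_or_ge m (pos N) with h2 | h2
      · exact ih.2 m h2
      · have := (h N (hone N)).1 (m - pos N) (by omega)
        rwa [Nat.add_sub_cancel' h2] at this
  exact fun n => (hall (n + 1)).2 n (hall (n + 1)).1

/-! ### Periodic sequences -/

/-- The periodic sequence repeating the first `k` terms of `s`. -/
def per (s : ℕ → ℤ) (k : ℕ) : ℕ → ℤ := fun n => s (n % k)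

theorem per_of_lt (s : ℕ → ℤ) {k n : ℕ} (h : n < k) : per s k n = s n := by
  rw [per, Nat.mod_eq_of_lt h]

theorem per_add (s : ℕ → ℤ) (k n : ℕ) : per s k (n + k) = per s k n := by
  simp [per]

theorem shift_per (s : ℕ → ℤ) (k : ℕ) : shift (per s k) k = per s k := by
  funext n
  rw [shift_apply, add_comm, per_add]

theorem perSeq_map_range (a : ℕ → ℤ) {k : ℕ} (hk : 1 ≤ k) :
    perSeq ((List.range k).map a) = per a k := by
  funext n
  have h : n % k < k := Nat.mod_lt _ hk
  simp only [perSeq, per, List.length_map, List.length_range]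
  exact getD_map_range a h

theorem perSeq_map_range_append (a : ℕ → ℤ) (m : ℕ) (d : ℤ) :
    perSeq ((List.range m).map a ++ [d]) = per (Function.update a m d) (m + 1) := by
  funext n
  have h : n % (m + 1) < m + 1 := Nat.mod_lt _ (Nat.succ_pos m)
  simp only [perSeq, per, List.length_append, List.length_map, List.length_range,
    List.length_singleton]
  rcases Nat.lt_succ_iff_lt_or_eq.1 h with h1 | h1
  · rw [getD_map_range_append a _ h1, Function.update_of_ne h1.ne]
  · rw [h1, Function.update_self]
    simp

theorem orb_per {γ : ℝ} {s : ℕ → ℤ} {k : ℕ} (hk : 1 ≤ k) (h : orb γ 1 s k = 1) (n : ℕ) :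
    orb γ 1 (per s k) n = orb γ 1 s (n % k) := by
  have hlt : ∀ r ≤ k, orb γ 1 (per s k) r = orb γ 1 s r := fun r hr =>
    orb_congr γ 1 fun i hi => per_of_lt s (hi.trans_le hr)
  have hadd : ∀ r, orb γ 1 (per s k) (k + r) = orb γ 1 (per s k) r := by
    intro r
    rw [orb_add, hlt k le_rfl, h, shift_per]
  induction n using Nat.strong_induction_on with
  | _ n ih =>
    rcases Nat.lt_or_ge n k with h1 | h1
    · rw [hlt n h1.le, Nat.mod_eq_of_lt h1]
    · obtain ⟨r, rfl⟩ := Nat.exists_eq_add_of_le h1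
      rw [hadd, ih r (by omega), Nat.add_mod_left]

theorem valid_per {γ : ℝ} {s : ℕ → ℤ} {k : ℕ} (hk : 1 ≤ k) (hs : ∀ n, 0 ≤ s n)
    (h01 : ∀ i < k, orb γ 1 s i ∈ Icc (0 : ℝ) 1) (h : orb γ 1 s k = 1) : Valid γ (per s k) :=
  ⟨fun n => hs _, fun n => by
    rw [orb_per hk h]
    exact h01 _ (Nat.mod_lt _ hk)⟩

theorem orb_eq_one_of_valid_per {γ : ℝ} (hγ : 1 < γ) {s : ℕ → ℤ} {k : ℕ}
    (h : Valid γ (per s k)) : orb γ 1 s k = 1 := by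
  have h1 := h.val_shift hγ k
  rw [shift_per, h.val_eq hγ, orb_congr γ 1 fun i hi => per_of_lt s hi] at h1
  exact h1.symm

theorem condG_per {s : ℕ → ℤ} {k : ℕ} (hk : 1 ≤ k)
    (h : ∀ j, 0 < j → j < k → ∀ i < k, (∀ l < i, per s k l = per s k (l + j)) →
      ¬ (if Even i then per s k i < per s k (i + j) else per s k (i + j) < per s k i)) :
    CondG (per s k) := by
  intro j _
  have hmod : (fun n => per s k (n + j)) = fun n => per s k (n + j % k) := by
    funext n
    simp [per]
  rw [hmod]
  have hjk : j % k < k := Nat.mod_lt _ hk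
  rcases Nat.eq_zero_or_pos (j % k) with h0 | h0
  · rw [h0]
    exact Or.inr rfl
  · refine altLe_of_not_altLt ?_
    rintro ⟨i, hi, hlt⟩
    beta_reduce at hi hlt
    rcases Nat.lt_or_ge i k with h1 | h1
    · exact h _ h0 hjk i h1 hi hlt
    · obtain ⟨r, rfl⟩ := Nat.exists_eq_add_of_le h1
      have h2 := hi r (by omega)
      have h3 := per_add s k r
      have h4 := per_add s k (r + j % k)
      rw [add_comm k r] at hlt
      have h5 : r + k + j % k = r + j % k + k := by omega
      rw [h5, h3, h4, h2] at hlt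
      simp at hlt

/-! ### The two conditions on concatenations -/

theorem valid_unique {β γ : ℝ} (hβ : 1 < β) (hγ : 1 < γ) {a : ℕ → ℤ} (h : Valid β a)
    (h' : Valid γ a) : β = γ := by
  rcases lt_trichotomy β γ with h1 | h1 | h1
  · exact absurd (altLt_of_lt hβ h1 h h') (altLt_irrefl a)
  · exact h1
  · exact absurd (altLt_of_lt hγ h1 h' h) (altLt_irrefl a)

theorem orb_add_of_recurrence {γ : ℝ} {a : ℕ → ℤ} {n t : ℕ} (hn : orb γ 1 a n = 1)
    (h : ∀ i < t, a (n + i) = a i) : orb γ 1 a (n + t) = orb γ 1 a t := by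
  rw [orb_add, hn]
  exact orb_congr γ 1 h

theorem exists_first_boundary {β : ℝ} {a : ℕ → ℤ} {n : ℕ} (hn : 1 ≤ n) (h : orb β 1 a n = 0) :
    ∃ m, (orb β 1 a (m + 1) = 0 ∨ orb β 1 a (m + 1) = 1) ∧
      ∀ i < m, orb β 1 a (i + 1) ≠ 0 ∧ orb β 1 a (i + 1) ≠ 1 := by
  classical
  have hex : ∃ m, orb β 1 a (m + 1) = 0 ∨ orb β 1 a (m + 1) = 1 :=
    ⟨n - 1, Or.inl (by rwa [Nat.sub_add_cancel hn])⟩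
  exact ⟨Nat.find hex, Nat.find_spec hex, fun i hi => not_or.1 (Nat.find_min hex hi)⟩

/-- After a return to `1`, the sequence follows its own beginning up to the first boundary point. -/
theorem recurrence_of_orb_eq_one {β : ℝ} {a : ℕ → ℤ} (ha : Valid β a) {m n : ℕ}
    (hm : ∀ i < m, orb β 1 a (i + 1) ≠ 0 ∧ orb β 1 a (i + 1) ≠ 1) (hn : orb β 1 a n = 1) :
    (∀ i < m, a (n + i) = a i) ∧ (a (n + m) = a m ∨
      (orb β 1 a (n + (m + 1)) = 1 ∧ orb β 1 a (m + 1) = 0 ∧ a (n + m) = a m + 1) ∨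
      (orb β 1 a (n + (m + 1)) = 0 ∧ orb β 1 a (m + 1) = 1 ∧ a m = a (n + m) + 1)) := by
  have horb : ∀ t, orb β 1 (shift a n) t = orb β 1 a (n + t) := fun t => by
    rw [orb_add, hn]
  have hdiff : ∀ j, (∀ i < j, a (n + i) = a i) → a (n + j) ≠ a j →
      (orb β 1 a (n + (j + 1)) = 1 ∧ orb β 1 a (j + 1) = 0 ∧ a (n + j) = a j + 1) ∨
      (orb β 1 a (n + (j + 1)) = 0 ∧ orb β 1 a (j + 1) = 1 ∧ a j = a (n + j) + 1) := by
    intro j hj hne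
    have := orb_of_first_ne (β := β) (x := 1) (s := shift a n) (t := a) hj hne
      (by rw [horb]; exact ha.2 _) (ha.2 _)
    rwa [horb] at this
  have hpre : ∀ i, i < m → a (n + i) = a i := by
    intro i
    induction i using Nat.strong_induction_on with
    | _ i ih =>
      intro hi
      by_contra hne
      rcases hdiff i (fun l hl => ih l hl (hl.trans hi)) hne with h | h
      · exact (hm i hi).1 h.2.1
      · exact (hm i hi).2 h.2.1
  refine ⟨hpre, ?_⟩
  by_cases h : a (n + m) = a m
  · exact Or.inl h
  · exact Or.inr (hdiff m hpre h)

theorem next_of_orb_eq_zero {β : ℝ} {a : ℕ → ℤ} (ha : Valid β a) {n : ℕ}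
    (hn : orb β 1 a n = 0) : a n = 0 ∧ orb β 1 a (n + 1) = 1 := by
  have h1 := (ha.2 (n + 1)).2
  rw [orb_succ, hn] at h1
  have h2 : (a n : ℝ) ≤ ((0 : ℤ) : ℝ) := by push_cast; linarith
  have h3 : a n = 0 := le_antisymm (by exact_mod_cast h2) (ha.1 n)
  refine ⟨h3, ?_⟩
  rw [orb_succ, hn, h3]
  simp

theorem orb_ne_zero_of_cond {β : ℝ} (hβ : 1 < β) {a : ℕ → ℤ} (ha : Valid β a) (h1 : CondA1 a)
    (h2 : CondA2 a) {n : ℕ} (hn : 1 ≤ n) : orb β 1 a n ≠ 0 := by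
  intro hzero
  obtain ⟨m, hm01, hm⟩ := exists_first_boundary hn hzero
  have h01 : ∀ i < m + 1, orb β 1 a i ∈ Icc (0 : ℝ) 1 := fun i _ => ha.2 i
  rcases hm01 with hm0 | hm1
  · set s := Function.update a m (a m + 1) with hs
    have hs_eq : ∀ i < m, s i = a i := fun i hi => Function.update_of_ne hi.ne _ _
    have hsm : s m = a m + 1 := Function.update_self _ _ _
    have hs0 : ∀ i, 0 ≤ s i := by
      intro i
      rcases eq_or_ne i m with rfl | hne
      · rw [hsm]
        have := ha.1 i
        omega
      · rw [hs, Function.update_of_ne hne]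
        exact ha.1 i
    have horb : ∀ i ≤ m, orb β 1 s i = orb β 1 a i := fun i hi =>
      orb_congr β 1 fun l hl => hs_eq l (by omega)
    have hval : Valid β (per s (m + 1)) := by
      refine valid_per (by omega) hs0 (fun i hi => ?_) ?_
      · rw [horb i (by omega)]
        exact ha.2 i
      · rw [orb_succ] at hm0 ⊢
        rw [horb m le_rfl, hsm]
        push_cast
        linarith
    refine h2 (m + 1) (by omega) ?_ ?_
    · rw [Nat.add_sub_cancel, perSeq_map_range_append]
      exact uSeq_altLt hβ hval
    · rw [Nat.add_sub_cancel]
      refine isInfConcat_of_step (fun n => orb β 1 a n = 1) rfl fun n hQ => ?_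
      obtain ⟨hpre, hcase⟩ := recurrence_of_orb_eq_one ha hm hQ
      rcases hcase with h | h | h
      · have hx : orb β 1 a (n + (m + 1)) = 0 := by
          rw [orb_add_of_recurrence hQ fun i hi => ?_, hm0]
          rcases Nat.lt_succ_iff_lt_or_eq.1 hi with h3 | rfl
          · exact hpre i h3
          · exact h
        obtain ⟨hd, hx1⟩ := next_of_orb_eq_zero ha hx
        refine ⟨_, Or.inl rfl, ?_, ?_⟩
        · intro i hi
          simp only [List.length_append, List.length_map, List.length_range,
            List.length_singleton] at hi
          rcases Nat.lt_succ_iff_lt_or_eq.1 hi with h3 | rfl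
          · rw [getD_map_range_append a _ h3]
            rcases Nat.lt_succ_iff_lt_or_eq.1 h3 with h4 | rfl
            · exact (hpre i h4).symm
            · exact h.symm
          · rw [hd]
            simp
        · simpa [add_assoc] using hx1
      · refine ⟨_, Or.inr rfl, ?_, ?_⟩
        · intro i hi
          simp only [List.length_append, List.length_map, List.length_range,
            List.length_singleton] at hi
          rcases Nat.lt_succ_iff_lt_or_eq.1 hi with h3 | rfl
          · rw [getD_map_range_append a _ h3]
            exact (hpre i h3).symm
          · rw [h.2.2]
            simp
        · simpa using h.1
      · exact absurd (hm0.symm.trans h.2.1) zero_ne_one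
  · have hval : Valid β (per a (m + 1)) := valid_per (by omega) ha.1 h01 hm1
    have heq := h1 (m + 1) (by omega) (by
      rw [perSeq_map_range a (by omega)]
      exact uSeq_altLt hβ hval) (by
      rw [Nat.add_sub_cancel]
      refine isInfConcat_of_step (fun n => orb β 1 a n = 1) rfl fun n hQ => ?_
      obtain ⟨hpre, hcase⟩ := recurrence_of_orb_eq_one ha hm hQ
      rcases hcase with h | h | h
      · have hpre' : ∀ i < m + 1, a (n + i) = a i := by
          intro i hi
          rcases Nat.lt_succ_iff_lt_or_eq.1 hi with h3 | rfl
          · exact hpre i h3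
          · exact h
        refine ⟨_, Or.inl rfl, ?_, ?_⟩
        · intro i hi
          simp only [List.length_map, List.length_range] at hi
          rw [getD_map_range a hi]
          exact (hpre' i hi).symm
        · simp only [List.length_map, List.length_range]
          rw [orb_add_of_recurrence hQ hpre', hm1]
      · exact absurd (hm1.symm.trans h.2.1) one_ne_zero
      · obtain ⟨hd, hx1⟩ := next_of_orb_eq_zero ha h.1
        refine ⟨_, Or.inr rfl, ?_, ?_⟩
        · intro i hi
          simp only [List.length_append, List.length_map, List.length_range, List.length_cons,
            List.length_nil] at hi
          rcases Nat.lt_or_ge i m with h3 | h3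
          · rw [getD_map_range_append a _ h3]
            exact (hpre i h3).symm
          · obtain rfl | rfl : i = m ∨ i = m + 1 := by omega
            · have := getD_map_range_append_right a [a i - 1, 0] i 0
              rw [add_zero] at this
              rw [this, h.2.2]
              simp
            · rw [hd]
              simp
        · simpa [add_assoc] using hx1)
    rw [perSeq_map_range a (by omega)] at heq
    have h3 := orb_per (by omega : 1 ≤ m + 1) hm1 n
    rw [← heq, hzero] at h3
    have hlt : n % (m + 1) < m + 1 := Nat.mod_lt _ (by omega)
    rcases hr : n % (m + 1) with _ | r
    · rw [hr] at h3
      simp at h3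
    · rw [hr] at h3 hlt
      exact (hm r (by omega)).1 h3.symm

theorem _root_.CondG.le_of_agreement {a : ℕ → ℤ} (hG : CondG a) {j i : ℕ}
    (h : ∀ l < i, a (j + l) = a l) :
    if Even i then a (j + i) ≤ a i else a i ≤ a (j + i) := by
  have h1 := (hG.shift_le j).not_altLt
  by_contra hcon
  refine h1 ⟨i, fun l hl => (h l hl).symm, ?_⟩
  split_ifs at hcon ⊢ with he
  · exact not_le.1 hcon
  · exact not_le.1 hcon

theorem condA1_of_ne_zero {β : ℝ} (hβ : 1 < β) {a : ℕ → ℤ} (ha : Valid β a) (hG : CondG a)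
    (hne : ∀ n, 1 ≤ n → orb β 1 a n ≠ 0) : CondA1 a := by
  intro k hk hlt hcat
  obtain ⟨m, rfl⟩ : ∃ m, k = m + 1 := ⟨k - 1, by omega⟩
  rw [Nat.add_sub_cancel] at hcat
  rw [perSeq_map_range a hk] at hlt ⊢
  obtain ⟨w, pos, h0, h⟩ := hcat.exists_positions
  have hblock : ∀ N, ((w N).length = m + 1 ∧ ∀ i < m + 1, a (pos N + i) = a i) ∨
      ((w N).length = m + 2 ∧ (∀ i < m, a (pos N + i) = a i) ∧ a (pos N + m) = a m - 1 ∧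
        a (pos N + (m + 1)) = 0) := by
    intro N
    obtain ⟨hw, -, hd⟩ := h N
    rcases hw with hw | hw
    · rw [hw] at hd ⊢
      have hlen : ((List.range (m + 1)).map a).length = m + 1 := by simp
      refine Or.inl ⟨hlen, fun i hi => ?_⟩
      rw [← hd i (by omega), getD_map_range a hi]
    · rw [hw] at hd ⊢
      have hlen : ((List.range m).map a ++ [a m - 1, 0]).length = m + 2 := by simp
      refine Or.inr ⟨hlen, fun i hi => ?_, ?_, ?_⟩
      · rw [← hd i (by omega), getD_map_range_append a _ hi]
      · rw [← hd m (by omega)]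
        exact getD_map_range_append_right a [a m - 1, 0] m 0
      · rw [← hd (m + 1) (by omega)]
        exact getD_map_range_append_right a [a m - 1, 0] m 1
  have hpos1 : pos 1 = m + 1 := by
    have h1 := (h 0).2.1
    rcases hblock 0 with h2 | h2
    · rw [h1, h0, h2.1, Nat.zero_add]
    · have h3 := h2.2.2.1
      rw [h0, Nat.zero_add] at h3
      omega
  have hsecond : ∀ t < m, a (m + 1 + t) = a t := by
    intro t ht
    rcases hblock 1 with h2 | h2
    · rw [← hpos1]
      exact h2.2 t (by omega)
    · rw [← hpos1]
      exact h2.2.1 t ht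
  have hc : ∀ n < 2 * m + 1, per a (m + 1) n = a n := by
    intro n hn
    rcases Nat.lt_or_ge n (m + 1) with h1 | h1
    · exact per_of_lt a h1
    · obtain ⟨t, rfl⟩ := Nat.exists_eq_add_of_le h1
      rw [hsecond t (by omega), add_comm (m + 1) t, per_add, per_of_lt a (by omega)]
  have hGc : CondG (per a (m + 1)) := by
    refine condG_per hk fun j hj0 hjk i hi heq => ?_
    have h1 : ∀ l < i, a (j + l) = a l := by
      intro l hl
      have := heq l hl
      rw [hc l (by omega), hc (l + j) (by omega), add_comm l j] at this
      exact this.symm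
    have h2 := hG.le_of_agreement h1
    rw [hc i (by omega), hc (i + j) (by omega), add_comm i j]
    split_ifs at h2 ⊢ with he
    · exact not_lt.2 h2
    · exact not_lt.2 h2
  obtain ⟨γ, hγ, hval⟩ := exists_valid (c := per a (m + 1)) (fun n => ha.1 _) hGc hlt
  have hone := orb_eq_one_of_valid_per hγ hval
  have h01 : ∀ t < m + 1, orb γ 1 a t ∈ Icc (0 : ℝ) 1 := by
    intro t ht
    have := hval.2 t
    rwa [orb_per hk hone, Nat.mod_eq_of_lt ht] at this
  have hγa : Valid γ a := by
    refine valid_of_blocks ha.1 (L := fun N => (w N).length) h0 (fun N => (h N).2.1)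
      (fun N => ?_) (fun N hN => ?_)
    · rcases hblock N with h1 | h1 <;> have := h1.1 <;> omega
    · rcases hblock N with ⟨hlen, h1⟩ | ⟨hlen, h1, h2, h3⟩
      · rw [hlen]
        refine ⟨fun t ht => ?_, ?_⟩
        · rw [orb_add_of_recurrence hN fun i hi => h1 i (by omega)]
          exact h01 t ht
        · rw [orb_add_of_recurrence hN h1, hone]
      · rw [hlen]
        have hx : orb γ 1 a (pos N + (m + 1)) = 0 := by
          rw [orb_succ] at hone
          rw [← add_assoc, orb_succ, orb_add_of_recurrence hN h1, h2]
          push_cast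
          linarith
        refine ⟨fun t ht => ?_, ?_⟩
        · rcases Nat.lt_or_ge t (m + 1) with h4 | h4
          · rw [orb_add_of_recurrence hN fun i hi => h1 i (by omega)]
            exact h01 t h4
          · obtain rfl : t = m + 1 := by omega
            rw [hx]
            simp
        · rw [show pos N + (m + 2) = pos N + (m + 1) + 1 by omega, orb_succ, hx, h3]
          simp
  obtain rfl := valid_unique hβ hγ ha hγa
  have hshift : shift a (m + 1) = a := by
    by_contra hcon
    obtain ⟨i, hi, hd⟩ := exists_first_ne hcon
    have horb : ∀ t, orb β 1 (shift a (m + 1)) t = orb β 1 a (m + 1 + t) := fun t => by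
      rw [orb_add, hone]
    rcases orb_of_first_ne (β := β) (x := 1) hi hd (by rw [horb]; exact ha.2 _) (ha.2 _) with
      h1 | h1
    · exact hne (i + 1) (by omega) h1.2.1
    · rw [horb] at h1
      exact hne _ (by omega) h1.1
  funext n
  induction n using Nat.strong_induction_on with
  | _ n ih =>
    rcases Nat.lt_or_ge n (m + 1) with h1 | h1
    · rw [per_of_lt a h1]
    · obtain ⟨r, rfl⟩ := Nat.exists_eq_add_of_le h1
      rw [add_comm (m + 1) r, per_add, ← ih r (by omega), add_comm r]
      exact congrFun hshift r

/-- The periodic sequence from condition (A2) inherits condition (G) when the period is even. -/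
theorem condG_per_update {β : ℝ} (hβ : 1 < β) {a : ℕ → ℤ} (ha : Valid β a) (hG : CondG a)
    (hne : ∀ n, 1 ≤ n → orb β 1 a n ≠ 0) {m : ℕ} (hm : ¬ Even m) (hzero : a (m + 1) = 0)
    (hsecond : ∀ t < m, a (m + 2 + t) = a t) :
    CondG (per (Function.update a m (a m + 1)) (m + 1)) := by
  set s := Function.update a m (a m + 1) with hs
  have hs_eq : ∀ i < m, s i = a i := fun i hi => Function.update_of_ne hi.ne _ _
  have hsm : s m = a m + 1 := Function.update_self _ _ _
  have key : ∀ j i, 0 < j → i + j ≤ m → (∀ l < i, s l = s (l + j)) →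
      ¬ (if Even i then s i < s (i + j) else s (i + j) < s i) := by
    intro j i hj hij heq hlt
    have h1 : ∀ l < i, a (j + l) = a l := by
      intro l hl
      have := heq l hl
      rw [hs_eq l (by omega), hs_eq (l + j) (by omega), add_comm l j] at this
      exact this.symm
    have h2 := hG.le_of_agreement h1
    rw [add_comm i j] at hlt
    rw [hs_eq i (by omega)] at hlt
    rcases Nat.lt_or_eq_of_le hij with h3 | h3
    · rw [hs_eq (j + i) (by omega)] at hlt
      split_ifs at h2 hlt with he <;> omega
    have hji : j + i = m := by omega
    rw [hji, hsm] at hlt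
    rw [hji] at h2
    split_ifs at h2 hlt with he
    swap
    · omega
    have hodd : ¬ Even j := by
      intro h4
      exact hm (hji ▸ h4.add he)
    have hpre1 : ∀ l < i + 1, a (j + l) = a l := by
      intro l hl
      rcases Nat.lt_succ_iff_lt_or_eq.1 hl with h4 | rfl
      · exact h1 l h4
      · rw [hji]
        omega
    have hz : a (i + 1) = 0 := by
      have h4 := hG.le_of_agreement hpre1
      rw [if_neg (by simpa [Nat.even_add_one] using he), show j + (i + 1) = m + 1 by omega,
        hzero] at h4
      exact le_antisymm h4 (ha.1 _)
    have hpre2 : ∀ l < i + 2, a (j + l) = a l := by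
      intro l hl
      rcases Nat.lt_succ_iff_lt_or_eq.1 hl with h4 | rfl
      · exact hpre1 l h4
      · rw [show j + (i + 1) = m + 1 by omega, hzero, hz]
    have hpre3 : ∀ t < m, a (i + 2 + t) = a t := by
      intro t
      induction t using Nat.strong_induction_on with
      | _ t ih =>
        intro ht
        have h4 := hG.le_of_agreement (j := i + 2) (i := t) fun l hl => ih l hl (by omega)
        have h5 := hG.le_of_agreement (j := j) (i := i + 2 + t) fun l hl => by
          rcases Nat.lt_or_ge l (i + 2) with h6 | h6
          · exact hpre2 l h6
          · obtain ⟨r, rfl⟩ := Nat.exists_eq_add_of_le h6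
            rw [ih r (by omega) (by omega), show j + (i + 2 + r) = m + 2 + r by omega]
            exact hsecond r (by omega)
        have h6 : Even (i + 2 + t) ↔ Even t := by
          simp [Nat.even_add, he]
        rw [show j + (i + 2 + t) = m + 2 + t by omega, hsecond t ht] at h5
        simp only [h6] at h5
        split_ifs at h4 h5 <;> omega
    have hx1 : orb β 1 a (m + 2) = orb β 1 a j + β ^ j * (1 - orb β 1 a (i + 2)) := by
      have h4 := orb_sub_orb β (orb β 1 a (i + 2)) 1 (s := shift a (i + 2)) (t := a) (n := j)
        fun t ht => hpre3 t (by omega)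
      rw [← orb_add, show i + 2 + j = m + 2 by omega,
        (Nat.not_even_iff_odd.1 hodd).neg_pow] at h4
      linarith
    have hx2 : orb β 1 a (m + 2) = orb β 1 a (i + 2) - β ^ (i + 2) * (1 - orb β 1 a j) := by
      have h4 := orb_sub_orb β (orb β 1 a j) 1 (s := shift a j) (t := a) (n := i + 2) hpre2
      rw [← orb_add, show j + (i + 2) = m + 2 by omega,
        (show Even (i + 2) from he.add even_two).neg_pow] at h4
      linarith
    have hxj := ha.2 j
    have hxi := ha.2 (i + 2)
    have hb1 : (0 : ℝ) < β ^ j := by positivity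
    have hb2 : (1 : ℝ) ≤ β ^ (i + 2) := one_le_pow₀ hβ.le
    have hx3 : orb β 1 a (i + 2) = 1 := by
      have h4 : (1 - orb β 1 a (i + 2)) * (1 + β ^ j) =
          (1 - orb β 1 a j) * (1 - β ^ (i + 2)) := by linarith
      have h5 : (1 - orb β 1 a j) * (1 - β ^ (i + 2)) ≤ 0 :=
        mul_nonpos_of_nonneg_of_nonpos (by linarith [hxj.2]) (by linarith)
      have h6 : 0 ≤ (1 - orb β 1 a (i + 2)) * β ^ j :=
        mul_nonneg (by linarith [hxi.2]) hb1.le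
      linarith [hxi.2]
    rw [show i + 2 = i + 1 + 1 from rfl, orb_succ, hz] at hx3
    have h4 : β * orb β 1 a (i + 1) = 0 := by
      push_cast at hx3
      linarith
    rcases mul_eq_zero.1 h4 with h5 | h5
    · linarith
    · exact hne (i + 1) (by omega) h5
  refine condG_per (by omega) fun j hj0 hjk i hi heq hlt => ?_
  rcases Nat.lt_or_ge (i + j) (m + 1) with h1 | h1
  · refine key j i hj0 (by omega) (fun l hl => ?_) ?_
    · have := heq l hl
      rwa [per_of_lt s (by omega), per_of_lt s (by omega)] at this
    · rwa [per_of_lt s hi, per_of_lt s h1] at hlt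
  · obtain ⟨l, hl⟩ : ∃ l, l + 1 + j = m + 1 := ⟨m - j, by omega⟩
    obtain ⟨r, rfl⟩ : ∃ r, i = r + (l + 1) := ⟨i - (l + 1), by omega⟩
    have hper : ∀ t, t ≤ r → per s (m + 1) (t + (l + 1) + j) = s t := by
      intro t ht
      rw [add_assoc, hl, per_add, per_of_lt s (by omega)]
    have heven : Even l := by
      by_contra hodd
      have h2 : ∀ t < l, a (j + t) = a t := by
        intro t ht
        have := heq t (by omega)
        rw [per_of_lt s (by omega), per_of_lt s (by omega), hs_eq t (by omega),
          hs_eq (t + j) (by omega), add_comm t j] at this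
        exact this.symm
      have h3 := hG.le_of_agreement h2
      have h4 := heq l (by omega)
      rw [if_neg hodd, show j + l = m by omega] at h3
      rw [per_of_lt s (by omega), per_of_lt s (by omega), show l + j = m by omega, hsm,
        hs_eq l (by omega)] at h4
      omega
    refine key (l + 1) r (by omega) (by omega) (fun t ht => ?_) ?_
    · have := heq (t + (l + 1)) (by omega)
      rw [hper t ht.le, per_of_lt s (by omega)] at this
      exact this.symm
    · rw [hper r le_rfl, per_of_lt s hi] at hlt
      have h2 : Even (r + (l + 1)) ↔ ¬ Even r := by
        simp [Nat.even_add, heven]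
      by_cases he : Even r
      · rw [if_neg (by rw [h2]; exact not_not.2 he)] at hlt
        rwa [if_pos he]
      · rw [if_pos (h2.2 he)] at hlt
        rwa [if_neg he]

theorem condA2_of_ne_zero {β : ℝ} (hβ : 1 < β) {a : ℕ → ℤ} (ha : Valid β a) (hG : CondG a)
    (hne : ∀ n, 1 ≤ n → orb β 1 a n ≠ 0) : CondA2 a := by
  intro k hk hlt hcat
  obtain ⟨m, rfl⟩ : ∃ m, k = m + 1 := ⟨k - 1, by omega⟩
  rw [Nat.add_sub_cancel] at hcat hlt
  rw [perSeq_map_range_append] at hlt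
  obtain ⟨w, pos, h0, h⟩ := hcat.exists_positions
  have hblock : ∀ N, ((w N).length = m + 2 ∧ (∀ i < m + 1, a (pos N + i) = a i) ∧
        a (pos N + (m + 1)) = 0) ∨
      ((w N).length = m + 1 ∧ (∀ i < m, a (pos N + i) = a i) ∧ a (pos N + m) = a m + 1) := by
    intro N
    obtain ⟨hw, -, hd⟩ := h N
    rcases hw with hw | hw
    · rw [hw] at hd ⊢
      have hlen : ((List.range (m + 1)).map a ++ [0]).length = m + 2 := by simp
      refine Or.inl ⟨hlen, fun i hi => ?_, ?_⟩
      · rw [← hd i (by omega), getD_map_range_append a _ hi]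
      · rw [← hd (m + 1) (by omega)]
        exact getD_map_range_append_right a [0] (m + 1) 0
    · rw [hw] at hd ⊢
      have hlen : ((List.range m).map a ++ [a m + 1]).length = m + 1 := by simp
      refine Or.inr ⟨hlen, fun i hi => ?_, ?_⟩
      · rw [← hd i (by omega), getD_map_range_append a _ hi]
      · rw [← hd m (by omega)]
        exact getD_map_range_append_right a [a m + 1] m 0
  have hxm : 0 < orb β 1 a (m + 1) :=
    lt_of_le_of_ne (ha.2 _).1 (hne (m + 1) (by omega)).symm
  by_cases hm : Even m
  · have hall : ∀ N, (w N).length = m + 2 ∧ (∀ i < m + 1, a (pos N + i) = a i) ∧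
        a (pos N + (m + 1)) = 0 := by
      intro N
      rcases hblock N with h1 | ⟨-, h1, h2⟩
      · exact h1
      exfalso
      have h3 := orb_sub_orb β (orb β 1 a (pos N)) 1 (s := shift a (pos N)) (t := a) (n := m) h1
      rw [← orb_add, hm.neg_pow] at h3
      have h4 := (ha.2 (pos N + m + 1)).2
      rw [orb_succ, h2] at h4
      rw [orb_succ] at hxm
      have h5 : 0 ≤ β * (β ^ m * (1 - orb β 1 a (pos N))) := by
        have := (ha.2 (pos N)).2
        exact mul_nonneg (by linarith) (mul_nonneg (by positivity) (by linarith))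
      have h6 : orb β 1 a (pos N + m) = orb β 1 a m - β ^ m * (1 - orb β 1 a (pos N)) := by
        linarith
      rw [h6] at h4
      push_cast at h4
      linarith
    have hgrow : ∀ N : ℕ, (N : ℝ) * (β * orb β 1 a (m + 1)) ≤ 1 - orb β 1 a (pos N) := by
      intro N
      induction N with
      | zero => simp [h0]
      | succ N ih =>
        obtain ⟨hlen, h1, h2⟩ := hall N
        have h3 := orb_sub_orb β (orb β 1 a (pos N)) 1 (s := shift a (pos N)) (t := a)
          (n := m + 1) h1
        rw [← orb_add, hm.add_one.neg_pow] at h3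
        have h4 : orb β 1 a (pos N + (m + 1)) =
            orb β 1 a (m + 1) + β ^ (m + 1) * (1 - orb β 1 a (pos N)) := by linarith
        rw [(h N).2.1, hlen, show pos N + (m + 2) = pos N + (m + 1) + 1 by omega,
          orb_succ β 1 a (pos N + (m + 1)), h2, h4]
        have h5 : (1 : ℝ) ≤ β ^ (m + 2) := one_le_pow₀ hβ.le
        have h6 : 0 ≤ (β ^ (m + 2) - 1) * (1 - orb β 1 a (pos N)) :=
          mul_nonneg (by linarith) (by linarith [(ha.2 (pos N)).2])
        rw [pow_succ β (m + 1)] at h6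
        push_cast
        linarith
    have hd0 : 0 < β * orb β 1 a (m + 1) := mul_pos (by linarith) hxm
    obtain ⟨N, hN⟩ := exists_nat_gt (1 / (β * orb β 1 a (m + 1)))
    rw [div_lt_iff₀ hd0] at hN
    linarith [hgrow N, (ha.2 (pos N)).1]
  have hfirst : pos 1 = m + 2 ∧ a (m + 1) = 0 := by
    have h1 := (h 0).2.1
    rcases hblock 0 with h2 | h2
    · refine ⟨by rw [h1, h0, h2.1, Nat.zero_add], ?_⟩
      have h3 := h2.2.2
      rwa [h0, Nat.zero_add] at h3
    · have h3 := h2.2.2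
      rw [h0, Nat.zero_add] at h3
      omega
  have hsecond : ∀ t < m, a (m + 2 + t) = a t := by
    intro t ht
    rw [← hfirst.1]
    rcases hblock 1 with h2 | h2
    · exact h2.2.1 t (by omega)
    · exact h2.2.1 t ht
  have hGc := condG_per_update hβ ha hG hne hm hfirst.2 hsecond
  have hs0 : ∀ i, 0 ≤ Function.update a m (a m + 1) i := by
    intro i
    rcases eq_or_ne i m with rfl | hne
    · rw [Function.update_self]
      have := ha.1 i
      omega
    · rw [Function.update_of_ne hne]
      exact ha.1 i
  obtain ⟨γ, hγ, hval⟩ := exists_valid (c := per (Function.update a m (a m + 1)) (m + 1))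
    (fun n => hs0 _) hGc hlt
  have hone := orb_eq_one_of_valid_per hγ hval
  have horb : ∀ t ≤ m, orb γ 1 (Function.update a m (a m + 1)) t = orb γ 1 a t := fun t ht =>
    orb_congr γ 1 fun l hl => Function.update_of_ne (by omega) _ _
  have h01 : ∀ t < m + 1, orb γ 1 a t ∈ Icc (0 : ℝ) 1 := by
    intro t ht
    have := hval.2 t
    rwa [orb_per hk hone, Nat.mod_eq_of_lt ht, horb t (by omega)] at this
  rw [orb_succ, horb m le_rfl, Function.update_self] at hone
  push_cast at hone
  have hγ0 : orb γ 1 a (m + 1) = 0 := by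
    rw [orb_succ]
    linarith
  have hγa : Valid γ a := by
    refine valid_of_blocks ha.1 (L := fun N => (w N).length) h0 (fun N => (h N).2.1)
      (fun N => ?_) (fun N hN => ?_)
    · rcases hblock N with h1 | h1 <;> have := h1.1 <;> omega
    · rcases hblock N with ⟨hlen, h1, h2⟩ | ⟨hlen, h1, h2⟩
      · rw [hlen]
        refine ⟨fun t ht => ?_, ?_⟩
        · rw [orb_add_of_recurrence hN fun i hi => h1 i (by omega)]
          rcases Nat.lt_or_ge t (m + 1) with h3 | h3
          · exact h01 t h3
          · obtain rfl : t = m + 1 := by omega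
            rw [hγ0]
            simp
        · rw [show pos N + (m + 2) = pos N + (m + 1) + 1 by omega, orb_succ,
            orb_add_of_recurrence hN h1, hγ0, h2]
          simp
      · rw [hlen]
        refine ⟨fun t ht => ?_, ?_⟩
        · rw [orb_add_of_recurrence hN fun i hi => h1 i (by omega)]
          exact h01 t ht
        · rw [← add_assoc, orb_succ, orb_add_of_recurrence hN h1, h2]
          push_cast
          exact hone
  obtain rfl := valid_unique hβ hγ ha hγa
  exact hne (m + 1) (by omega) hγ0

end NegBeta

/-- under (G) and (L) there is a unique β > 1 with
−Σ_{j≥1}(a_j+1)/(−β)^j = 1 and all shifted sums in [0,1]; moreover the shifted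
sums are all nonzero iff (A1) and (A2) hold. -/
theorem stmt_3 (a : ℕ → ℤ) (hpos : ∀ n, 0 ≤ a n) (hG : CondG a) (hL : CondL a) :
    (∃! β : ℝ, 1 < β ∧
      (-(∑' j : ℕ, ((a j : ℝ) + 1) / (-β) ^ (j + 1)) = 1 ∧
        ∀ k : ℕ, 1 ≤ k →
          -(∑' j : ℕ, ((a (k + j) : ℝ) + 1) / (-β) ^ (j + 1)) ∈ Set.Icc (0 : ℝ) 1)) ∧
    ∀ β : ℝ, 1 < β →
      (-(∑' j : ℕ, ((a j : ℝ) + 1) / (-β) ^ (j + 1)) = 1 ∧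
        ∀ k : ℕ, 1 ≤ k →
          -(∑' j : ℕ, ((a (k + j) : ℝ) + 1) / (-β) ^ (j + 1)) ∈ Set.Icc (0 : ℝ) 1) →
      ((∀ k : ℕ, 1 ≤ k → (∑' j : ℕ, ((a (k + j) : ℝ) + 1) / (-β) ^ (j + 1)) ≠ 0) ↔
        (CondA1 a ∧ CondA2 a)) := by
  have hb : ∀ n, (a n : ℝ) ≤ (a 0 : ℝ) := fun n => by exact_mod_cast hG.le_head n
  have hvalid : ∀ β : ℝ, 1 < β →
      (-(∑' j : ℕ, ((a j : ℝ) + 1) / (-β) ^ (j + 1)) = 1 ∧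
        ∀ k : ℕ, 1 ≤ k →
          -(∑' j : ℕ, ((a (k + j) : ℝ) + 1) / (-β) ^ (j + 1)) ∈ Set.Icc (0 : ℝ) 1) →
      NegBeta.Valid β a := by
    rintro β hβ ⟨h1, h2⟩
    refine NegBeta.valid_of_val hβ hpos hb h1 fun n => ?_
    rcases Nat.eq_zero_or_pos n with rfl | hn
    · rw [NegBeta.shift_zero]
      exact ⟨h1.ge.trans' zero_le_one, h1.le⟩
    · exact h2 n hn
  obtain ⟨γ, hγ, hval⟩ := NegBeta.exists_valid hpos hG hL
  refine ⟨⟨γ, ⟨hγ, hval.val_eq hγ, fun k _ => hval.val_shift_mem hγ k⟩, fun β hβ =>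
    NegBeta.valid_unique hβ.1 hγ (hvalid β hβ.1 hβ.2) hval⟩, fun β hβ h => ?_⟩
  have ha := hvalid β hβ h
  have horb : ∀ k, -(∑' j : ℕ, ((a (k + j) : ℝ) + 1) / (-β) ^ (j + 1)) =
      NegBeta.orb β 1 a k := ha.val_shift hβ
  constructor
  · intro hne
    have hne' : ∀ n, 1 ≤ n → NegBeta.orb β 1 a n ≠ 0 := fun n hn => by
      rw [← horb]
      exact neg_ne_zero.2 (hne n hn)
    exact ⟨NegBeta.condA1_of_ne_zero hβ ha hG hne', NegBeta.condA2_of_ne_zero hβ ha hG hne'⟩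
  · rintro ⟨hA1, hA2⟩ k hk
    rw [← neg_ne_zero, horb]
    exact NegBeta.orb_ne_zero_of_cond hβ ha hA1 hA2 hk
end

section
/- For every β > 1, lim_{n→∞} (1/n) log L_{β,n} = lim_{n→∞} (1/n) log L'_{β,n} = log β. -/
open Filter Set

/-- The interval on which the (−β)-transformation acts. -/
def negBetaInterval (β : ℝ) : Set ℝ := Set.Ico (-β / (β + 1)) (1 / (β + 1))

/-- The word formed by the first `n` digits of the (−β)-expansion of `x`. -/
noncomputable def negBetaWord (β : ℝ) (n : ℕ) (x : ℝ) : List ℤ :=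
  (List.range n).map (negBetaDigit β x)

theorem length_negBetaWord (β : ℝ) (n : ℕ) (x : ℝ) : (negBetaWord β n x).length = n := by
  simp [negBetaWord]

theorem negBetaWord_eq_iff {β : ℝ} {n : ℕ} {x : ℝ} {w : List ℤ} (hw : w.length = n) :
    negBetaWord β n x = w ↔ ∀ i, i < n → negBetaDigit β x i = w.getD i 0 := by
  constructor
  · rintro rfl i hi
    simp [negBetaWord, hi]
  · intro h
    apply List.ext_getElem
    · simp [negBetaWord, hw]
    · intro i h₁ h₂
      have := h i (hw ▸ h₂)
      simp [negBetaWord, this, h₂]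

theorem cylinder_eq {β : ℝ} {n : ℕ} {w : List ℤ} (hw : w.length = n) :
    cylinder β w = {x | x ∈ negBetaInterval β ∧ negBetaWord β n x = w} := by
  ext x
  simp only [cylinder, negBetaInterval, mem_ofPred_eq, negBetaWord_eq_iff hw, hw]

theorem mem_cylinder_negBetaWord {β x : ℝ} (hx : x ∈ negBetaInterval β) (n : ℕ) :
    x ∈ cylinder β (negBetaWord β n x) := by
  rw [cylinder_eq (length_negBetaWord β n x)]
  exact ⟨hx, rfl⟩

theorem negBetaT_mem {β : ℝ} (hβ : 1 < β) (x : ℝ) : negBetaT β x ∈ negBetaInterval β := by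
  have h₁ := Int.floor_le (β / (β + 1) - β * x)
  have h₂ := Int.lt_floor_add_one (β / (β + 1) - β * x)
  have h₃ : β / (β + 1) + 1 / (β + 1) = 1 := by field_simp
  have h₄ : -β / (β + 1) = -(β / (β + 1)) := by ring
  simp only [negBetaT, negBetaInterval, mem_Ico]
  constructor <;> linarith

theorem iterate_negBetaT_mem {β : ℝ} (hβ : 1 < β) {x : ℝ} (hx : x ∈ negBetaInterval β) (n : ℕ) :
    (negBetaT β)^[n] x ∈ negBetaInterval β := by
  cases n with
  | zero => exact hx
  | succ n =>
    rw [Function.iterate_succ_apply']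
    exact negBetaT_mem hβ _

theorem negBetaWord_succ (β : ℝ) (n : ℕ) (x : ℝ) :
    negBetaWord β (n + 1) x = negBetaWord β n x ++ [negBetaDigit β x n] := by
  simp [negBetaWord, List.range_succ]

theorem negBetaWord_add (β : ℝ) (n m : ℕ) (x : ℝ) :
    negBetaWord β (n + m) x = negBetaWord β n x ++ negBetaWord β m ((negBetaT β)^[n] x) := by
  simp only [negBetaWord, List.range_add, List.map_append, List.map_map]
  congr 1
  apply List.map_congr_left
  intro i _
  simp only [Function.comp, negBetaDigit]
  rw [add_comm n i, Function.iterate_add_apply]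

theorem negBetaWord_succ_eq_iff {β : ℝ} {n : ℕ} {x y : ℝ} :
    negBetaWord β (n + 1) x = negBetaWord β (n + 1) y ↔
      negBetaWord β n x = negBetaWord β n y ∧ negBetaDigit β x n = negBetaDigit β y n := by
  simp only [negBetaWord_succ]
  constructor
  · intro h
    have := List.append_inj h (by simp [length_negBetaWord])
    simpa using this
  · rintro ⟨h₁, h₂⟩
    rw [h₁, h₂]

/-- On a cylinder of length `n` the `n`-th iterate is affine with slope `(−β)^n`. -/
theorem iterate_negBetaT_sub {β : ℝ} {n : ℕ} {x y : ℝ}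
    (h : negBetaWord β n x = negBetaWord β n y) :
    (negBetaT β)^[n] x - (negBetaT β)^[n] y = (-β) ^ n * (x - y) := by
  induction n with
  | zero => simp
  | succ n ih =>
    obtain ⟨h₁, h₂⟩ := negBetaWord_succ_eq_iff.1 h
    have ih := ih h₁
    simp only [negBetaDigit] at h₂
    simp only [Function.iterate_succ_apply', negBetaT]
    rw [h₂, pow_succ]
    linear_combination (-β) * ih

theorem abs_iterate_negBetaT_sub {β : ℝ} (hβ : 1 < β) {n : ℕ} {x y : ℝ}
    (h : negBetaWord β n x = negBetaWord β n y) :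
    |(negBetaT β)^[n] x - (negBetaT β)^[n] y| = β ^ n * |x - y| := by
  rw [iterate_negBetaT_sub h, abs_mul, abs_pow, abs_neg, abs_of_pos (by linarith : 0 < β)]

theorem negBetaWord_eq_of_mem_Icc {β : ℝ} (hβ : 1 < β) {n : ℕ} {x y z : ℝ}
    (h : negBetaWord β n x = negBetaWord β n y) (hz : z ∈ Icc x y) :
    negBetaWord β n z = negBetaWord β n x := by
  induction n with
  | zero => simp [negBetaWord]
  | succ n ih =>
    obtain ⟨h₁, h₂⟩ := negBetaWord_succ_eq_iff.1 h
    have hzx := ih h₁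
    refine negBetaWord_succ_eq_iff.2 ⟨hzx, ?_⟩
    have e₁ := iterate_negBetaT_sub hzx
    have e₂ := iterate_negBetaT_sub (hzx.trans h₁)
    have b₁ : 0 ≤ z - x := by linarith [hz.1]
    have b₂ : 0 ≤ y - z := by linarith [hz.2]
    have hβ₀ : 0 ≤ β := by linarith
    simp only [negBetaDigit] at h₂ ⊢
    rcases le_total 0 ((-β) ^ n) with hs | hs
    · have l₁ : (negBetaT β)^[n] x ≤ (negBetaT β)^[n] z := by nlinarith
      have l₂ : (negBetaT β)^[n] z ≤ (negBetaT β)^[n] y := by nlinarith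
      apply le_antisymm
      · apply Int.floor_le_floor
        nlinarith
      · rw [h₂]
        apply Int.floor_le_floor
        nlinarith
    · have l₁ : (negBetaT β)^[n] z ≤ (negBetaT β)^[n] x := by nlinarith
      have l₂ : (negBetaT β)^[n] y ≤ (negBetaT β)^[n] z := by nlinarith
      apply le_antisymm
      · rw [h₂]
        apply Int.floor_le_floor
        nlinarith
      · apply Int.floor_le_floor
        nlinarith

theorem ordConnected_cylinder {β : ℝ} (hβ : 1 < β) (w : List ℤ) :
    (cylinder β w).OrdConnected := by
  rw [cylinder_eq rfl]
  refine ⟨fun x hx y hy z hz => ⟨?_, ?_⟩⟩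
  · exact ordConnected_Ico.out hx.1 hy.1 hz
  · rw [negBetaWord_eq_of_mem_Icc hβ (hx.2.trans hy.2.symm) hz, hx.2]

theorem ordConnected_image_cylinder {β : ℝ} (hβ : 1 < β) {n : ℕ} {w : List ℤ} (hw : w.length = n) :
    ((negBetaT β)^[n] '' cylinder β w).OrdConnected := by
  have hc := ordConnected_cylinder hβ w
  rcases (cylinder β w).eq_empty_or_nonempty with he | ⟨x₀, hx₀⟩
  · rw [he, image_empty]
    exact ordConnected_empty
  have himage : (negBetaT β)^[n] '' cylinder β w =
      (fun x => (negBetaT β)^[n] x₀ + (-β) ^ n * (x - x₀)) '' cylinder β w := by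
    apply image_congr
    intro x hx
    rw [cylinder_eq hw] at hx hx₀
    have := iterate_negBetaT_sub (hx.2.trans hx₀.2.symm)
    linarith
  rw [himage]
  apply IsPreconnected.ordConnected
  exact hc.isPreconnected.image _ (by fun_prop)

theorem finite_admissible {β : ℝ} (hβ : 1 < β) (n : ℕ) :
    {w : List ℤ | w.length = n ∧ (cylinder β w).Nonempty}.Finite := by
  have hf : (Set.univ.pi fun _ : Fin n => Icc (0 : ℤ) ⌊β + 1⌋).Finite :=
    Set.Finite.pi fun _ => finite_Icc _ _
  refine (hf.image List.ofFn).subset ?_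
  rintro w ⟨rfl, x, hx⟩
  rw [cylinder_eq rfl] at hx
  refine ⟨fun i => w.get i, ?_, List.ofFn_get w⟩
  intro i _
  have hi := (negBetaWord_eq_iff rfl).1 hx.2 i i.2
  have hy := iterate_negBetaT_mem hβ hx.1 i
  have hd : w.get i = negBetaDigit β x i := by simp [hi]
  simp only [hd, negBetaDigit, mem_Icc]
  set y := (negBetaT β)^[(i : ℕ)] x
  obtain ⟨hy₁, hy₂⟩ := hy
  have hp : 0 < β + 1 := by linarith
  have h₁ : β * (1 / (β + 1)) = β / (β + 1) := by ring
  have h₂ : β / (β + 1) < 1 := (div_lt_one hp).2 (by linarith)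
  have h₃ : -β / (β + 1) = -(β / (β + 1)) := by ring
  constructor
  · apply Int.floor_nonneg.2
    nlinarith
  · apply Int.floor_le_floor
    nlinarith

/-- The words of length `n` with non-empty cylinder. -/
noncomputable def admissibleWords {β : ℝ} (hβ : 1 < β) (n : ℕ) : Finset (List ℤ) :=
  (finite_admissible hβ n).toFinset

theorem mem_admissibleWords {β : ℝ} (hβ : 1 < β) {n : ℕ} {w : List ℤ} :
    w ∈ admissibleWords hβ n ↔ w.length = n ∧ (cylinder β w).Nonempty := by
  simp [admissibleWords]

theorem Lnum_eq_card {β : ℝ} (hβ : 1 < β) (n : ℕ) : Lnum β n = (admissibleWords hβ n).card :=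
  Set.ncard_eq_toFinset_card _ (finite_admissible hβ n)

theorem eq_of_mem_cylinder {β x : ℝ} {v w : List ℤ} (h : v.length = w.length)
    (hv : x ∈ cylinder β v) (hw : x ∈ cylinder β w) : v = w := by
  rw [cylinder_eq h] at hv
  rw [cylinder_eq rfl] at hw
  exact hv.2.symm.trans hw.2

theorem volume_negBetaInterval {β : ℝ} (hβ : 1 < β) :
    MeasureTheory.volume (negBetaInterval β) = 1 := by
  rw [negBetaInterval, Real.volume_Ico, show 1 / (β + 1) - -β / (β + 1) = 1 by field_simp; ring]
  simp

/-- A short interval meets at most three members of a finite family of disjoint intervals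
with well-separated representatives. -/
theorem card_le_three_of_meets_short {ι : Type*} [DecidableEq ι] {B : Finset ι} {C : ι → Set ℝ}
    {J : Set ℝ} {p : ι → ℝ} {δ : ℝ} (hC : ∀ b ∈ B, (C b).OrdConnected)
    (hdisj : ∀ b ∈ B, ∀ b' ∈ B, ∀ x, x ∈ C b → x ∈ C b' → b = b') (hJ : J.OrdConnected)
    (hp : ∀ b ∈ B, p b ∈ C b) (hδ : ∀ b ∈ B, ∀ b' ∈ B, b ≠ b' → δ ≤ |p b - p b'|)
    (hshort : ∀ x ∈ J, ∀ y ∈ J, |x - y| < δ) (hmeet : ∀ b ∈ B, (J ∩ C b).Nonempty) :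
    B.card ≤ 3 := by
  by_contra! hcard
  choose! x hx using hmeet
  have hne : B.Nonempty := Finset.card_pos.1 (by omega)
  obtain ⟨a, ha, hmin⟩ := B.exists_min_image x hne
  obtain ⟨c, hc, hmax⟩ := B.exists_max_image x hne
  have h₁ := Finset.pred_card_le_card_erase (s := B) (a := a)
  have h₂ := Finset.pred_card_le_card_erase (s := B.erase a) (a := c)
  obtain ⟨b, hb, b', hb', hbb⟩ := Finset.one_lt_card.1 (by omega : 1 < ((B.erase a).erase c).card)
  have key : ∀ b ∈ (B.erase a).erase c, b ∈ B ∧ p b ∈ J := by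
    intro b hb
    simp only [Finset.mem_erase] at hb
    obtain ⟨hbc, hba, hbB⟩ := hb
    refine ⟨hbB, hJ.out (hx a ha).1 (hx c hc).1 ⟨?_, ?_⟩⟩
    · by_contra! hlt
      exact hba (hdisj b hbB a ha (x a)
        ((hC b hbB).out (hp b hbB) (hx b hbB).2 ⟨hlt.le, hmin b hbB⟩) (hx a ha).2)
    · by_contra! hlt
      exact hbc (hdisj b hbB c hc (x c)
        ((hC b hbB).out (hx b hbB).2 (hp b hbB) ⟨hmax b hbB, hlt.le⟩) (hx c hc).2)
  obtain ⟨hbB, hbJ⟩ := key b hb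
  obtain ⟨hbB', hbJ'⟩ := key b' hb'
  linarith [hshort _ hbJ _ hbJ', hδ b hbB b' hbB' hbb]

theorem exists_separation {ι : Type*} [DecidableEq ι] (B : Finset ι) {p : ι → ℝ}
    (hp : ∀ b ∈ B, ∀ b' ∈ B, p b = p b' → b = b') :
    ∃ δ > 0, ∀ b ∈ B, ∀ b' ∈ B, b ≠ b' → δ ≤ |p b - p b'| := by
  rcases B.offDiag.eq_empty_or_nonempty with he | hne
  · refine ⟨1, one_pos, fun b hb b' hb' h => ?_⟩
    have : (b, b') ∈ B.offDiag := Finset.mem_offDiag.2 ⟨hb, hb', h⟩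
    simp [he] at this
  · obtain ⟨q, hq, hmin⟩ := B.offDiag.exists_min_image (fun q => |p q.1 - p q.2|) hne
    obtain ⟨h₁, h₂, h₃⟩ := Finset.mem_offDiag.1 hq
    refine ⟨|p q.1 - p q.2|, abs_pos.2 fun h => h₃ (hp _ h₁ _ h₂ (sub_eq_zero.1 h)), ?_⟩
    intro b hb b' hb' h
    exact hmin (b, b') (Finset.mem_offDiag.2 ⟨hb, hb', h⟩)

/-- Few cylinders contain two points whose `n`-th images are at distance at least `δ`. -/
theorem card_mul_le_of_long {β : ℝ} (hβ : 1 < β) {n : ℕ} {δ : ℝ} {S : Finset (List ℤ)}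
    (hS : ∀ w ∈ S, w.length = n ∧ ∃ x ∈ cylinder β w, ∃ y ∈ cylinder β w,
      δ ≤ |(negBetaT β)^[n] x - (negBetaT β)^[n] y|) (hδ : 0 < δ) :
    (S.card : ℝ) * δ ≤ β ^ n := by
  have hβn : 0 < β ^ n := pow_pos (by linarith) n
  have hsub : ∀ w ∈ S, ∃ x y : ℝ, δ / β ^ n ≤ y - x ∧ Icc x y ⊆ cylinder β w := by
    intro w hw
    obtain ⟨hlen, x, hx, y, hy, hxy⟩ := hS w hw
    have hx' := hx
    have hy' := hy
    rw [cylinder_eq hlen] at hx' hy'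
    rw [abs_iterate_negBetaT_sub hβ (hx'.2.trans hy'.2.symm)] at hxy
    have hxy' : δ / β ^ n ≤ |x - y| := (div_le_iff₀' hβn).2 hxy
    rcases le_total x y with h | h
    · exact ⟨x, y, by rwa [abs_sub_comm, abs_of_nonneg (sub_nonneg.2 h)] at hxy',
        (ordConnected_cylinder hβ w).out hx hy⟩
    · exact ⟨y, x, by rwa [abs_of_nonneg (sub_nonneg.2 h)] at hxy',
        (ordConnected_cylinder hβ w).out hy hx⟩
  choose! x y hxy hcyl using hsub
  have hdisj : (S : Set (List ℤ)).PairwiseDisjoint fun w => Icc (x w) (y w) := by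
    intro v hv w hw hvw
    refine Set.disjoint_left.2 fun z hz hz' => hvw ?_
    exact eq_of_mem_cylinder ((hS v hv).1.trans (hS w hw).1.symm) (hcyl v hv hz) (hcyl w hw hz')
  have hvol : MeasureTheory.volume (⋃ w ∈ S, Icc (x w) (y w)) ≤ 1 := by
    rw [← volume_negBetaInterval hβ]
    exact MeasureTheory.measure_mono (iUnion₂_subset fun w hw z hz => (hcyl w hw hz).1)
  rw [MeasureTheory.measure_biUnion_finset hdisj fun _ _ => measurableSet_Icc] at hvol
  simp only [Real.volume_Icc] at hvol
  have hpos : ∀ w ∈ S, 0 ≤ y w - x w := fun w hw => (by positivity : 0 ≤ δ / β ^ n).trans (hxy w hw)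
  rw [← ENNReal.ofReal_sum_of_nonneg hpos, ENNReal.ofReal_le_one] at hvol
  have := (Finset.card_nsmul_le_sum S _ _ hxy).trans hvol
  rw [nsmul_eq_mul, ← mul_div_assoc, div_le_one hβn] at this
  exact this

theorem exists_Lnum_add_le {β : ℝ} (hβ : 1 < β) (m : ℕ) :
    ∃ K : ℝ, ∀ n, (Lnum β (n + m) : ℝ) ≤ 3 * Lnum β n + K * β ^ n := by
  classical
  have hrep : ∀ b ∈ admissibleWords hβ m, (cylinder β b).Nonempty :=
    fun b hb => ((mem_admissibleWords hβ).1 hb).2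
  choose! p hp using hrep
  have hlen : ∀ b ∈ admissibleWords hβ m, ∀ b' ∈ admissibleWords hβ m, b.length = b'.length :=
    fun b hb b' hb' =>
      ((mem_admissibleWords hβ).1 hb).1.trans ((mem_admissibleWords hβ).1 hb').1.symm
  obtain ⟨δ, hδ₀, hδ⟩ := exists_separation (admissibleWords hβ m) (p := p)
    fun b hb b' hb' h => eq_of_mem_cylinder (hlen b hb b' hb') (hp b hb) (h ▸ hp b' hb')
  refine ⟨Lnum β m / δ, fun n => ?_⟩
  set fiber : List ℤ → Finset (List ℤ) :=
    fun w => (admissibleWords hβ (n + m)).filter fun v => v.take n = w with hfiber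
  set next : List ℤ → Finset (List ℤ) := fun w => (admissibleWords hβ m).filter
    fun b => ((negBetaT β)^[n] '' cylinder β w ∩ cylinder β b).Nonempty with hnext
  have hsplit : ∀ v ∈ admissibleWords hβ (n + m), ∃ x ∈ cylinder β (v.take n),
      v.take n ∈ admissibleWords hβ n ∧ v.drop n ∈ admissibleWords hβ m ∧
      (negBetaT β)^[n] x ∈ cylinder β (v.drop n) := by
    intro v hv
    obtain ⟨hvl, x, hx⟩ := (mem_admissibleWords hβ).1 hv
    rw [cylinder_eq hvl] at hx
    obtain ⟨hxI, hxv⟩ := hx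
    rw [negBetaWord_add] at hxv
    have ht : v.take n = negBetaWord β n x := by
      rw [← hxv, List.take_left' (length_negBetaWord β n x)]
    have hd : v.drop n = negBetaWord β m ((negBetaT β)^[n] x) := by
      rw [← hxv, List.drop_left' (length_negBetaWord β n x)]
    have h₁ := mem_cylinder_negBetaWord hxI n
    have h₂ := mem_cylinder_negBetaWord (iterate_negBetaT_mem hβ hxI n) m
    rw [ht, hd]
    exact ⟨x, h₁, (mem_admissibleWords hβ).2 ⟨length_negBetaWord _ _ _, _, h₁⟩,
      (mem_admissibleWords hβ).2 ⟨length_negBetaWord _ _ _, _, h₂⟩, h₂⟩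
  have hfn : ∀ w, (fiber w).card ≤ (next w).card := by
    intro w
    apply Finset.card_le_card_of_injOn (fun v => v.drop n)
    · intro v hv
      obtain ⟨hvA, rfl⟩ := Finset.mem_filter.1 hv
      obtain ⟨x, hx, -, hd, hxd⟩ := hsplit v hvA
      exact Finset.mem_filter.2 ⟨hd, _, mem_image_of_mem _ hx, hxd⟩
    · intro v hv v' hv' h
      have e := (Finset.mem_filter.1 hv).2
      have e' := (Finset.mem_filter.1 hv').2
      simp only at h
      rw [← List.take_append_drop n v, ← List.take_append_drop n v', e, e', h]
  set long := (admissibleWords hβ n).filter fun w => ∃ x ∈ cylinder β w, ∃ y ∈ cylinder β w,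
      δ ≤ |(negBetaT β)^[n] x - (negBetaT β)^[n] y| with hlong
  have hcard : ∀ w ∈ admissibleWords hβ n,
      (fiber w).card ≤ 3 + if w ∈ long then Lnum β m else 0 := by
    intro w hw
    refine (hfn w).trans ?_
    split_ifs with h
    · rw [Lnum_eq_card hβ]
      exact (Finset.card_filter_le _ _).trans (Nat.le_add_left _ _)
    · refine card_le_three_of_meets_short (C := cylinder β) (p := p) (δ := δ)
        (J := (negBetaT β)^[n] '' cylinder β w) (fun b _ => ordConnected_cylinder hβ b) ?_
        (ordConnected_image_cylinder hβ ((mem_admissibleWords hβ).1 hw).1) ?_ ?_ ?_ ?_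
      · intro b hb b' hb' x hx hx'
        exact eq_of_mem_cylinder
          (hlen b (Finset.mem_filter.1 hb).1 b' (Finset.mem_filter.1 hb').1) hx hx'
      · exact fun b hb => hp b (Finset.mem_filter.1 hb).1
      · exact fun b hb b' hb' => hδ b (Finset.mem_filter.1 hb).1 b' (Finset.mem_filter.1 hb').1
      · rintro _ ⟨x, hx, rfl⟩ _ ⟨y, hy, rfl⟩
        by_contra! hxy
        exact h (Finset.mem_filter.2 ⟨hw, x, hx, y, hy, hxy⟩)
      · exact fun b hb => (Finset.mem_filter.1 hb).2
  have hsum : Lnum β (n + m) ≤ 3 * Lnum β n + long.card * Lnum β m := by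
    calc Lnum β (n + m) = ∑ w ∈ admissibleWords hβ n, (fiber w).card := by
          rw [Lnum_eq_card hβ]
          refine Finset.card_eq_sum_card_fiberwise fun v hv => ?_
          obtain ⟨-, -, h, -⟩ := hsplit v hv
          exact h
      _ ≤ ∑ w ∈ admissibleWords hβ n, (3 + if w ∈ long then Lnum β m else 0) :=
          Finset.sum_le_sum hcard
      _ = 3 * Lnum β n + long.card * Lnum β m := by
          rw [Finset.sum_add_distrib, Finset.sum_const, ← Finset.sum_filter, Finset.sum_const,
            Lnum_eq_card hβ n, smul_eq_mul, smul_eq_mul, mul_comm 3, Finset.filter_mem_eq_inter,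
            Finset.inter_eq_right.2 (Finset.filter_subset _ _)]
  have hlongcard : (long.card : ℝ) * δ ≤ β ^ n := by
    refine card_mul_le_of_long hβ (fun w hw => ?_) hδ₀
    obtain ⟨h₁, h₂⟩ := Finset.mem_filter.1 hw
    exact ⟨((mem_admissibleWords hβ).1 h₁).1, h₂⟩
  have hsum' : (Lnum β (n + m) : ℝ) ≤ 3 * Lnum β n + long.card * Lnum β m := by
    exact_mod_cast hsum
  have hle : (long.card : ℝ) ≤ β ^ n / δ := (le_div_iff₀ hδ₀).2 hlongcard
  calc (Lnum β (n + m) : ℝ) ≤ 3 * Lnum β n + long.card * Lnum β m := hsum'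
    _ ≤ 3 * Lnum β n + β ^ n / δ * Lnum β m := by gcongr
    _ = 3 * Lnum β n + Lnum β m / δ * β ^ n := by ring

theorem exists_Lnum_le {β : ℝ} (hβ : 1 < β) : ∃ B : ℝ, 0 < B ∧ ∀ n, (Lnum β n : ℝ) ≤ B * β ^ n := by
  obtain ⟨m, hm⟩ := pow_unbounded_of_one_lt 6 hβ
  have hm₀ : 0 < m := by
    rcases Nat.eq_zero_or_pos m with rfl | h
    · norm_num at hm
    · exact h
  obtain ⟨K, hK⟩ := exists_Lnum_add_le hβ m
  set M : ℝ := ∑ i ∈ Finset.range m, (Lnum β i : ℝ) with hM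
  have hM₀ : 0 ≤ M := Finset.sum_nonneg fun _ _ => Nat.cast_nonneg _
  refine ⟨M + |K| + 1, by positivity, fun n => ?_⟩
  induction n using Nat.strong_induction_on with
  | _ n ih =>
    rcases lt_or_ge n m with h | h
    · have h₁ : (Lnum β n : ℝ) ≤ M := by
        rw [hM]
        exact Finset.single_le_sum (f := fun i => (Lnum β i : ℝ))
          (fun _ _ => Nat.cast_nonneg _) (Finset.mem_range.2 h)
      have h₂ : 1 ≤ β ^ n := one_le_pow₀ hβ.le
      have h₃ : 0 ≤ |K| := abs_nonneg K
      nlinarith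
    · obtain ⟨k, rfl⟩ := Nat.exists_eq_add_of_le' h
      have h₁ := ih k (by omega)
      have h₂ := hK k
      have hk : 0 < β ^ k := pow_pos (by linarith) k
      have h₃ : K * β ^ k ≤ |K| * β ^ k := by gcongr; exact le_abs_self K
      have h₄ : 0 ≤ |K| := abs_nonneg K
      have h₅ : (M + |K| + 1) * β ^ k * 6 ≤ (M + |K| + 1) * β ^ k * β ^ m := by gcongr
      have h₆ : |K| * β ^ k ≤ (M + |K| + 1) * β ^ k := by gcongr; linarith
      rw [pow_add]
      have : 0 ≤ |K| * β ^ k := by positivity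
      linarith

theorem Lnum'_le_Lnum {β : ℝ} (hβ : 1 < β) (n : ℕ) : Lnum' β n ≤ Lnum β n := by
  refine Set.ncard_le_ncard ?_ (finite_admissible hβ n)
  rintro w ⟨hw, c, d, hcd, h, -⟩
  exact ⟨hw, (nonempty_Ioo.2 hcd).mono h⟩

theorem volume_cylinder_le {β : ℝ} (hβ : 1 < β) {n : ℕ} {w : List ℤ} (hw : w.length = n) :
    MeasureTheory.volume (cylinder β w) ≤ ENNReal.ofReal (1 / β ^ n) := by
  have hβn : 0 < β ^ n := pow_pos (by linarith) n
  refine (Real.volume_le_diam _).trans (Metric.ediam_le fun x hx y hy => ?_)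
  rw [cylinder_eq hw] at hx hy
  rw [edist_dist, Real.dist_eq]
  apply ENNReal.ofReal_le_ofReal
  rw [le_div_iff₀' hβn, ← abs_iterate_negBetaT_sub hβ (hx.2.trans hy.2.symm)]
  have h₁ := iterate_negBetaT_mem hβ hx.1 n
  have h₂ := iterate_negBetaT_mem hβ hy.1 n
  have h₃ : 1 / (β + 1) - -β / (β + 1) = 1 := by field_simp; ring
  rw [abs_le]
  constructor <;> linarith [h₁.1, h₁.2, h₂.1, h₂.2]

theorem exists_Ioo_subset_of_nontrivial {s : Set ℝ} (hs : s.OrdConnected) (hn : s.Nontrivial)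
    (hb : BddBelow s) (ha : BddAbove s) : ∃ c d : ℝ, c < d ∧ Ioo c d ⊆ s ∧ s ⊆ Icc c d := by
  refine ⟨sInf s, sSup s, ?_, ?_, fun x hx => ⟨csInf_le hb hx, le_csSup ha hx⟩⟩
  · obtain ⟨x, hx, y, hy, hxy⟩ := hn.exists_lt
    exact (csInf_le hb hx).trans_lt (hxy.trans_le (le_csSup ha hy))
  · exact IsConnected.Ioo_csInf_csSup_subset ⟨hn.nonempty, hs.isPreconnected⟩ hb ha

theorem pow_le_Lnum' {β : ℝ} (hβ : 1 < β) (n : ℕ) : β ^ n ≤ Lnum' β n := by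
  classical
  have hβn : 0 < β ^ n := pow_pos (by linarith) n
  set S := (admissibleWords hβ n).filter fun w => (cylinder β w).Nontrivial with hS
  have hcard : S.card ≤ Lnum' β n := by
    rw [← Set.ncard_coe_finset S, Lnum']
    refine Set.ncard_le_ncard ?_ ((finite_admissible hβ n).subset ?_)
    · intro w hw
      obtain ⟨hw, hnt⟩ := Finset.mem_filter.1 hw
      exact ⟨((mem_admissibleWords hβ).1 hw).1,
        exists_Ioo_subset_of_nontrivial (ordConnected_cylinder hβ w) hnt
          (bddBelow_Ico.mono fun x hx => hx.1) (bddAbove_Ico.mono fun x hx => hx.1)⟩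
    · rintro w ⟨hw, c, d, hcd, h, -⟩
      exact ⟨hw, (nonempty_Ioo.2 hcd).mono h⟩
  have hcover : negBetaInterval β ⊆ ⋃ w ∈ admissibleWords hβ n, cylinder β w := by
    intro x hx
    have h := mem_cylinder_negBetaWord hx n
    exact mem_iUnion₂.2 ⟨_, (mem_admissibleWords hβ).2 ⟨length_negBetaWord β n x, x, h⟩, h⟩
  have hvol : (1 : ENNReal) ≤ S.card * ENNReal.ofReal (1 / β ^ n) := by
    calc (1 : ENNReal) = MeasureTheory.volume (negBetaInterval β) :=
          (volume_negBetaInterval hβ).symm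
      _ ≤ ∑ w ∈ admissibleWords hβ n, MeasureTheory.volume (cylinder β w) :=
          (MeasureTheory.measure_mono hcover).trans (MeasureTheory.measure_biUnion_finset_le _ _)
      _ = ∑ w ∈ S, MeasureTheory.volume (cylinder β w) := by
          refine (Finset.sum_subset (Finset.filter_subset _ _) fun w hw hwS => ?_).symm
          have : (cylinder β w).Subsingleton := by
            rw [← Set.not_nontrivial_iff]
            exact fun h => hwS (Finset.mem_filter.2 ⟨hw, h⟩)
          exact this.measure_zero _
      _ ≤ ∑ _w ∈ S, ENNReal.ofReal (1 / β ^ n) := by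
          refine Finset.sum_le_sum fun w hw => volume_cylinder_le hβ ?_
          exact ((mem_admissibleWords hβ).1 (Finset.mem_filter.1 hw).1).1
      _ = S.card * ENNReal.ofReal (1 / β ^ n) := by rw [Finset.sum_const, nsmul_eq_mul]
  rw [← ENNReal.ofReal_natCast, ← ENNReal.ofReal_mul (Nat.cast_nonneg _),
    ENNReal.one_le_ofReal, mul_one_div, le_div_iff₀ hβn, one_mul] at hvol
  exact hvol.trans (by exact_mod_cast hcard)

theorem tendsto_log_div_of_pow_bounds {β B : ℝ} (hβ : 0 < β) (hB : 0 < B) {f : ℕ → ℝ}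
    (hl : ∀ n, β ^ n ≤ f n) (hu : ∀ n, f n ≤ B * β ^ n) :
    Tendsto (fun n : ℕ => Real.log (f n) / n) atTop (nhds (Real.log β)) := by
  have hlim : Tendsto (fun n : ℕ => Real.log B / n + Real.log β) atTop (nhds (Real.log β)) := by
    simpa using (tendsto_const_div_atTop_nhds_zero_nat (Real.log B)).add_const (Real.log β)
  refine tendsto_of_tendsto_of_tendsto_of_le_of_le' tendsto_const_nhds hlim ?_ ?_
  · filter_upwards [eventually_gt_atTop 0] with n hn
    have hn' : (0 : ℝ) < n := Nat.cast_pos.2 hn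
    rw [le_div_iff₀' hn', ← Real.log_pow]
    exact Real.log_le_log (pow_pos hβ n) (hl n)
  · filter_upwards [eventually_gt_atTop 0] with n hn
    have hn' : (0 : ℝ) < n := Nat.cast_pos.2 hn
    have hp := pow_pos hβ n
    rw [div_add' _ _ _ hn'.ne', div_le_div_iff_of_pos_right hn', mul_comm (Real.log β),
      ← Real.log_pow, ← Real.log_mul hB.ne' hp.ne']
    exact Real.log_le_log (hp.trans_le (hl n)) (hu n)

/-- lim (1/n) log L_{β,n} = lim (1/n) log L'_{β,n} = log β. -/
theorem stmt_4 (β : ℝ) (hβ : 1 < β) :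
    Filter.Tendsto (fun n : ℕ => Real.log (Lnum β n) / n) Filter.atTop
      (nhds (Real.log β)) ∧
    Filter.Tendsto (fun n : ℕ => Real.log (Lnum' β n) / n) Filter.atTop
      (nhds (Real.log β)) := by
  obtain ⟨B, hB, hu⟩ := exists_Lnum_le hβ
  have hle : ∀ n, (Lnum' β n : ℝ) ≤ Lnum β n := fun n => by exact_mod_cast Lnum'_le_Lnum hβ n
  have hβ₀ : 0 < β := by linarith
  exact ⟨tendsto_log_div_of_pow_bounds hβ₀ hB (fun n => (pow_le_Lnum' hβ n).trans (hle n)) hu,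
    tendsto_log_div_of_pow_bounds hβ₀ hB (pow_le_Lnum' hβ) fun n => (hle n).trans (hu n)⟩
end

section
/- Let β > 1 and let a_1 a_2 ⋯ be the (−β)-expansion of −β/(β+1). Then a_k a_{k+1} ⋯ ≤_alt a_1 a_2 ⋯ for every k ≥ 2. -/
open Filter Set

theorem neg_div_le_negBetaT (β x : ℝ) : -β / (β + 1) ≤ negBetaT β x := by
  have h := Int.floor_le (β / (β + 1) - β * x)
  rw [negBetaT, neg_div]
  linarith

theorem negBetaT_iterate_succ (β x : ℝ) (n : ℕ) :
    (negBetaT β)^[n + 1] x = -β * (negBetaT β)^[n] x - negBetaDigit β x n := by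
  rw [Function.iterate_succ_apply']
  rfl

theorem negBetaDigit_iterate (β x : ℝ) (n k : ℕ) :
    negBetaDigit β ((negBetaT β)^[k] x) n = negBetaDigit β x (n + k) := by
  rw [negBetaDigit, negBetaDigit, Function.iterate_add_apply]

/-- While the digits of `x` and `y` agree, each step of the transformation reverses the order. -/
theorem negBetaT_iterate_order {β x y : ℝ} (hβ : 0 ≤ β) (hxy : x ≤ y) (n : ℕ)
    (h : ∀ i, i < n → negBetaDigit β x i = negBetaDigit β y i) :
    if Even n then (negBetaT β)^[n] x ≤ (negBetaT β)^[n] y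
    else (negBetaT β)^[n] y ≤ (negBetaT β)^[n] x := by
  induction n with
  | zero => simpa using hxy
  | succ n ih =>
    have ih := ih fun i hi => h i (hi.trans n.lt_succ_self)
    rw [negBetaT_iterate_succ, negBetaT_iterate_succ, h n n.lt_succ_self]
    by_cases hn : Even n
    · rw [if_pos hn] at ih
      rw [if_neg (by simpa [Nat.even_add_one] using hn)]
      linarith [mul_le_mul_of_nonneg_left ih hβ]
    · rw [if_neg hn] at ih
      rw [if_pos (by simpa [Nat.even_add_one] using hn)]
      linarith [mul_le_mul_of_nonneg_left ih hβ]

theorem negBetaDigit_le_of_iterate_le {β x y : ℝ} (hβ : 0 ≤ β) {n : ℕ}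
    (h : (negBetaT β)^[n] x ≤ (negBetaT β)^[n] y) :
    negBetaDigit β y n ≤ negBetaDigit β x n :=
  Int.floor_le_floor (sub_le_sub_left (mul_le_mul_of_nonneg_left h hβ) _)

/-- The (−β)-expansion reverses order, with respect to the alternating order on sequences. -/
theorem altLe_negBetaDigit_of_le {β x y : ℝ} (hβ : 0 ≤ β) (hxy : x ≤ y) :
    AltLe (negBetaDigit β y) (negBetaDigit β x) := by
  classical
  by_cases heq : negBetaDigit β y = negBetaDigit β x
  · exact Or.inr heq
  · have hex : ∃ n, negBetaDigit β y n ≠ negBetaDigit β x n := Function.ne_iff.mp heq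
    have hmin : ∀ i, i < Nat.find hex → negBetaDigit β y i = negBetaDigit β x i :=
      fun i hi => not_not.mp (Nat.find_min hex hi)
    have hne := Nat.find_spec hex
    have hord := negBetaT_iterate_order hβ hxy _ fun i hi => (hmin i hi).symm
    refine Or.inl ⟨Nat.find hex, hmin, ?_⟩
    split_ifs at hord ⊢
    · exact lt_of_le_of_ne (negBetaDigit_le_of_iterate_le hβ hord) hne
    · exact lt_of_le_of_ne (negBetaDigit_le_of_iterate_le hβ hord) hne.symm

/-- the (−β)-expansion a of −β/(β+1) satisfies
a_k a_{k+1}⋯ ≤_alt a_1 a_2⋯ for all k ≥ 2. -/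
theorem stmt_8 (β : ℝ) (hβ : 1 < β) (a : ℕ → ℤ) (ha : ∀ n, a n = negBetaExp β n) :
    ∀ k : ℕ, 1 ≤ k → AltLe (fun n => a (n + k)) a := by
  intro k hk
  obtain ⟨m, rfl⟩ := Nat.exists_eq_add_of_le' hk
  have hle : -β / (β + 1) ≤ (negBetaT β)^[m + 1] (-β / (β + 1)) := by
    rw [Function.iterate_succ_apply']
    exact neg_div_le_negBetaT β _
  have h := altLe_negBetaDigit_of_le (zero_le_one.trans hβ.le) hle
  have ha' : a = negBetaDigit β (-β / (β + 1)) := funext ha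
  rw [show negBetaDigit β ((negBetaT β)^[m + 1] (-β / (β + 1))) = _ from
    funext fun n => negBetaDigit_iterate β (-β / (β + 1)) n (m + 1)] at h
  rw [ha']
  exact h
end
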